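/- arXiv:2403.03753 — 8 statements merged into one kernel-verified Lean document; each statement's English description precedes it below -/
import Mathlib

section
/- The bilinear bracket on the complex vector space with basis {e_α : α ∈ ℤⁿ} ∪ {c_μ} (realized as (ℤⁿ →₀ ℂ) ⊕ ℂ) determined by [e_α, e_β] = μ·(β−α)·e_{α+β} + δ_{α,−β}·((μ·α)³ − μ·α)/12 · c_μ and [x, c_μ] = 0 is alternating and satisfies the Jacobi identity; hence it makes Vir(n)_μ := W(n)_μ ⊕ ℂc_μ into a complex Lie algebra (the solenoidal Virasoro algebra). -/
/-- The index lattice `ℤⁿ` (as functions `Fin n → ℤ`). -/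
abbrev Zn (n : ℕ) := Fin n → ℤ

/-- Underlying vector space of the solenoidal Witt algebra `W(n)_μ`:
finitely supported functions `ℤⁿ → ℂ`, with basis `e_α = single α 1`. -/
abbrev Wn (n : ℕ) := Zn n →₀ ℂ

/-- Underlying vector space of the solenoidal Virasoro algebra
`Vir(n)_μ = W(n)_μ ⊕ ℂ c_μ`. -/
abbrev Virn (n : ℕ) := Wn n × ℂ

/-- `μ·α = μ₁α₁ + ⋯ + μₙαₙ`. -/
noncomputable def mdot {n : ℕ} (μ : Fin n → ℂ) (α : Zn n) : ℂ :=
  ∑ i, μ i * (α i : ℂ)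

/-- `μ` is generic: `μ·α ≠ 0` for every nonzero `α ∈ ℤⁿ`. -/
def Generic {n : ℕ} (μ : Fin n → ℂ) : Prop :=
  ∀ α : Zn n, α ≠ 0 → mdot μ α ≠ 0

/-- The basis vector `e_α` of `Vir(n)_μ`. -/
noncomputable def ev {n : ℕ} (α : Zn n) : Virn n := (Finsupp.single α 1, 0)

/-- The central basis vector `c_μ` of `Vir(n)_μ`. -/
noncomputable def cv {n : ℕ} : Virn n := (0, 1)

theorem mdot_add {n : ℕ} (μ : Fin n → ℂ) (α β : Zn n) :
    mdot μ (α + β) = mdot μ α + mdot μ β := by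
  simp [mdot, mul_add, Finset.sum_add_distrib]

theorem mdot_neg {n : ℕ} (μ : Fin n → ℂ) (α : Zn n) : mdot μ (-α) = -mdot μ α := by
  simp [mdot]

theorem mdot_sub {n : ℕ} (μ : Fin n → ℂ) (α β : Zn n) :
    mdot μ (α - β) = mdot μ α - mdot μ β := by
  rw [sub_eq_add_neg, mdot_add, mdot_neg, sub_eq_add_neg]

theorem single_prod_eq {n : ℕ} (α : Zn n) (a b : ℂ) :
    ((Finsupp.single α a, b) : Virn n) = a • ev α + b • cv := by
  simp [ev, cv]

theorem Virn.induction {n : ℕ} {P : Virn n → Prop} (add : ∀ x y, P x → P y → P (x + y))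
    (smul : ∀ (a : ℂ) x, P x → P (a • x)) (basis : ∀ α, P (ev α)) (central : P cv)
    (x : Virn n) : P x := by
  obtain ⟨f, b⟩ := x
  induction f using Finsupp.induction_linear generalizing b with
  | zero => simpa [cv] using smul b _ central
  | add f g hf hg => simpa using add _ _ (hf b) (hg 0)
  | single α a =>
    rw [single_prod_eq]
    exact add _ _ (smul a _ (basis α)) (smul b _ central)

/-- The bilinear bracket on `Vir(n)_μ = W(n)_μ ⊕ ℂ c_μ` determined by
`[e_α, e_β] = μ·(β−α)·e_{α+β} + δ_{α,−β}·((μ·α)³ − μ·α)/12 · c_μ` and `[x, c_μ] = 0`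
(with `c_μ` central) is alternating and satisfies the Jacobi identity, hence makes
`Vir(n)_μ` a complex Lie algebra, the solenoidal Virasoro algebra. -/
theorem stmt0 (n : ℕ) (hn : 1 ≤ n) (μ : Fin n → ℂ) (hμ : Generic μ)
    (B : Virn n →ₗ[ℂ] Virn n →ₗ[ℂ] Virn n)
    (hBe : ∀ α β : Zn n, B (ev α) (ev β) =
      (Finsupp.single (α + β) (mdot μ (β - α)),
        if α = -β then ((mdot μ α) ^ 3 - mdot μ α) / 12 else 0))
    (hBc : ∀ x : Virn n, B x cv = 0)
    (hcB : ∀ x : Virn n, B cv x = 0) :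
    (∀ x : Virn n, B x x = 0) ∧
    (∀ x y z : Virn n, B x (B y z) + B y (B z x) + B z (B x y) = 0) := by
  have skew : ∀ x y : Virn n, B x y = -B y x := by
    intro x y
    induction x using Virn.induction with
    | add x x' hx hx' => simp only [map_add, LinearMap.add_apply, hx, hx', neg_add]
    | smul a x hx => simp only [map_smul, LinearMap.smul_apply, hx, smul_neg]
    | central => simp [hBc, hcB]
    | basis α =>
      induction y using Virn.induction with
      | add y y' hy hy' => simp only [map_add, LinearMap.add_apply, hy, hy', neg_add]
      | smul a y hy => simp only [map_smul, LinearMap.smul_apply, hy, smul_neg]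
      | central => simp [hBc, hcB]
      | basis β =>
        rw [hBe, hBe, Prod.neg_mk, add_comm β α, ← Finsupp.single_neg, ← mdot_neg, neg_sub]
        congr 1
        by_cases h : α = -β
        · subst h
          simp only [neg_neg, if_true, mdot_neg]
          ring
        · have h' : β ≠ -α := fun e => h (by rw [e, neg_neg])
          simp [h, h']
  refine ⟨fun x => self_eq_neg.mp (skew x x), fun x y z => ?_⟩
  induction x using Virn.induction with
  | add x x' hx hx' =>
    simp only [map_add, LinearMap.add_apply]
    linear_combination (norm := module) hx + hx'
  | smul a x hx =>
    simp only [map_smul, LinearMap.smul_apply]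
    linear_combination (norm := module) a • hx
  | central => simp [hBc, hcB]
  | basis α =>
    induction y using Virn.induction with
    | add y y' hy hy' =>
      simp only [map_add, LinearMap.add_apply]
      linear_combination (norm := module) hy + hy'
    | smul a y hy =>
      simp only [map_smul, LinearMap.smul_apply]
      linear_combination (norm := module) a • hy
    | central => simp [hBc, hcB]
    | basis β =>
      induction z using Virn.induction with
      | add z z' hz hz' =>
        simp only [map_add, LinearMap.add_apply]
        linear_combination (norm := module) hz + hz'
      | smul a z hz =>
        simp only [map_smul, LinearMap.smul_apply]
        linear_combination (norm := module) a • hz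
      | central => simp [hBc, hcB]
      | basis γ =>
        have double : ∀ α β γ : Zn n, B (ev α) (B (ev β) (ev γ)) =
            (Finsupp.single (α + β + γ) (mdot μ (γ - β) * mdot μ (β + γ - α)),
              if α + β + γ = 0 then
                mdot μ (γ - β) * (((mdot μ α) ^ 3 - mdot μ α) / 12) else 0) := by
          intro α β γ
          rw [hBe β γ, single_prod_eq, map_add, map_smul, map_smul, hBc, hBe, smul_zero,
            add_zero, Prod.smul_mk, Finsupp.smul_single, smul_eq_mul, smul_eq_mul, mul_ite,
            mul_zero, ← add_assoc]
          simp only [eq_neg_iff_add_eq_zero, add_assoc]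
        rw [double, double, double, show β + γ + α = α + β + γ by abel,
          show γ + α + β = α + β + γ by abel, Prod.mk_add_mk, Prod.mk_add_mk,
          ← Finsupp.single_add, ← Finsupp.single_add, Prod.mk_eq_zero,
          Finsupp.single_eq_zero]
        simp only [mdot_sub, mdot_add]
        constructor
        · ring
        · split_ifs with h
          · have hγ : γ = -(α + β) := eq_neg_of_add_eq_zero_right h
            rw [hγ, mdot_neg, mdot_add]
            ring
          · simp
end

section
/- Let θ : W(n)_μ × W(n)_μ → ℂ be an antisymmetric bilinear map satisfying the 2-cocycle identity θ(x, [y, z]) + θ(y, [z, x]) + θ(z, [x, y]) = 0, and suppose θ(e_0, e_α) = 0 for all nonzero α ∈ ℤⁿ. Then θ(e_α, e_β) = 0 whenever α + β ≠ 0. -/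
/-- The basis vector `e_α` of `W(n)_μ`. -/
noncomputable def ew {n : ℕ} (α : Zn n) : Wn n := Finsupp.single α 1

theorem single_eq_smul_ew {n : ℕ} (α : Zn n) (c : ℂ) : Finsupp.single α c = c • ew α := by
  simp [ew]

/-- If `θ` is an antisymmetric bilinear 2-cocycle on the solenoidal Witt algebra `W(n)_μ`
with `θ(e_0, e_α) = 0` for all nonzero `α`, then `θ(e_α, e_β) = 0` whenever `α + β ≠ 0`. -/
theorem stmt3 (n : ℕ) (hn : 1 ≤ n) (μ : Fin n → ℂ) (hμ : Generic μ)
    (B : Wn n →ₗ[ℂ] Wn n →ₗ[ℂ] Wn n)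
    (hB : ∀ α β : Zn n, B (ew α) (ew β) = Finsupp.single (α + β) (mdot μ (β - α)))
    (θ : Wn n →ₗ[ℂ] Wn n →ₗ[ℂ] ℂ)
    (hθskew : ∀ x y : Wn n, θ x y = - θ y x)
    (hθcoc : ∀ x y z : Wn n, θ x (B y z) + θ y (B z x) + θ z (B x y) = 0)
    (hθ0 : ∀ α : Zn n, α ≠ 0 → θ (ew 0) (ew α) = 0) :
    ∀ α β : Zn n, α + β ≠ 0 → θ (ew α) (ew β) = 0 := by
  intro α β hαβ
  have h := hθcoc (ew 0) (ew α) (ew β)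
  simp only [hB, single_eq_smul_ew, map_smul, smul_eq_mul, hθ0 _ hαβ, mul_zero, zero_add,
    add_zero, zero_sub, sub_zero, mdot_neg, hθskew (ew β) (ew α)] at h
  have key : mdot μ (α + β) * θ (ew α) (ew β) = 0 := by
    rw [mdot_add]
    linear_combination -h
  exact (mul_eq_zero.mp key).resolve_left (hμ _ hαβ)
end

section
/- Let θ : W(n)_μ × W(n)_μ → ℂ be an antisymmetric bilinear map satisfying the 2-cocycle identity θ(x, [y, z]) + θ(y, [z, x]) + θ(z, [x, y]) = 0, with θ(e_0, e_α) = 0 for all nonzero α, and define η : Γ_μ → ℂ by η(μ·α) := θ(e_α, e_{−α}) (well-defined since α ↦ μ·α is injective for generic μ). Then η is odd, i.e. η(−x) = −η(x) for all x ∈ Γ_μ, and η satisfies the functional equation 2x·η(x) − 2y·η(y) = (x − y)·η(x + y) + (x + y)·η(x − y) for all x, y ∈ Γ_μ. -/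
/-- The cocycle identity on `e_α, e_β, e_{-α-β}`, expressed through `f α = θ(e_α, e_{-α})`. -/
theorem cocycle_diagonal {n : ℕ} {μ : Fin n → ℂ} {B : Wn n →ₗ[ℂ] Wn n →ₗ[ℂ] Wn n}
    (hB : ∀ α β : Zn n, B (ew α) (ew β) = Finsupp.single (α + β) (mdot μ (β - α)))
    {θ : Wn n →ₗ[ℂ] Wn n →ₗ[ℂ] ℂ}
    (hθskew : ∀ x y : Wn n, θ x y = - θ y x)
    (hθcoc : ∀ x y z : Wn n, θ x (B y z) + θ y (B z x) + θ z (B x y) = 0)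
    (α β : Zn n) :
    (mdot μ α - mdot μ β) * θ (ew (α + β)) (ew (-(α + β))) =
      (mdot μ α + 2 * mdot μ β) * θ (ew α) (ew (-α)) -
        (2 * mdot μ α + mdot μ β) * θ (ew β) (ew (-β)) := by
  have single_eq (γ : Zn n) (c : ℂ) : (Finsupp.single γ c : Wn n) = c • ew γ := by simp [ew]
  have h := hθcoc (ew α) (ew β) (ew (-(α + β)))
  rw [hB, hB, hB, single_eq, single_eq, single_eq, map_smul, map_smul, map_smul,
    show β + -(α + β) = -α by abel, show -(α + β) + α = -β by abel,
    hθskew (ew (-(α + β)))] at h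
  simp only [smul_eq_mul, mdot_sub, mdot_neg, mdot_add] at h
  linear_combination h

/-- Let `θ` be an antisymmetric bilinear 2-cocycle on `W(n)_μ` with `θ(e_0, e_α) = 0`
for nonzero `α`, and let `η : Γ_μ → ℂ` be defined by `η(μ·α) = θ(e_α, e_{−α})`
(well defined since `α ↦ μ·α` is injective for generic `μ`; here `η` is any function
`ℂ → ℂ` satisfying this on `Γ_μ`). Then `η` is odd on `Γ_μ` and satisfies
`2x·η(x) − 2y·η(y) = (x − y)·η(x + y) + (x + y)·η(x − y)` for all `x, y ∈ Γ_μ`. -/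
theorem stmt4 (n : ℕ) (hn : 1 ≤ n) (μ : Fin n → ℂ) (hμ : Generic μ)
    (B : Wn n →ₗ[ℂ] Wn n →ₗ[ℂ] Wn n)
    (hB : ∀ α β : Zn n, B (ew α) (ew β) = Finsupp.single (α + β) (mdot μ (β - α)))
    (θ : Wn n →ₗ[ℂ] Wn n →ₗ[ℂ] ℂ)
    (hθskew : ∀ x y : Wn n, θ x y = - θ y x)
    (hθcoc : ∀ x y z : Wn n, θ x (B y z) + θ y (B z x) + θ z (B x y) = 0)
    (hθ0 : ∀ α : Zn n, α ≠ 0 → θ (ew 0) (ew α) = 0)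
    (η : ℂ → ℂ)
    (hη : ∀ α : Zn n, η (mdot μ α) = θ (ew α) (ew (-α))) :
    (∀ α : Zn n, η (-(mdot μ α)) = - η (mdot μ α)) ∧
    (∀ α β : Zn n,
      2 * mdot μ α * η (mdot μ α) - 2 * mdot μ β * η (mdot μ β) =
        (mdot μ α - mdot μ β) * η (mdot μ α + mdot μ β) +
          (mdot μ α + mdot μ β) * η (mdot μ α - mdot μ β)) := by
  have odd (α : Zn n) : η (-(mdot μ α)) = - η (mdot μ α) := by
    rw [← mdot_neg, hη, hη, neg_neg, hθskew]
  refine ⟨odd, fun α β => ?_⟩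
  have h₁ := cocycle_diagonal hB hθskew hθcoc α β
  have h₂ := cocycle_diagonal hB hθskew hθcoc α (-β)
  simp only [← hη, mdot_add, mdot_neg, odd] at h₁ h₂
  rw [← sub_eq_add_neg] at h₂
  linear_combination -h₁ - h₂
end

section
/- A polynomial η ∈ ℂ[X] satisfies 5x·η(x) − 4x·η(2x) + x·η(3x) = 0 for all x ∈ ℂ if and only if there exist a, b ∈ ℂ such that η(X) = a·X³ + b·X. -/
open Polynomial

lemma four_mul_two_pow_lt_three_pow (n : ℕ) (hn : 4 ≤ n) : 4 * 2 ^ n < 3 ^ n := by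
  induction n, hn using Nat.le_induction with
  | base => norm_num
  | succ k _ ih => rw [pow_succ, pow_succ]; omega

lemma eq_one_or_eq_three_of_five_add_three_pow (n : ℕ) (h : 5 + 3 ^ n = 4 * 2 ^ n) :
    n = 1 ∨ n = 3 := by
  rcases lt_or_ge n 4 with hn | hn
  · interval_cases n <;> simp_all
  · have := four_mul_two_pow_lt_three_pow n hn
    omega

/-- A polynomial `η ∈ ℂ[X]` satisfies `5x·η(x) − 4x·η(2x) + x·η(3x) = 0` for all `x ∈ ℂ`
if and only if `η = a·X³ + b·X` for some `a, b ∈ ℂ`. -/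
theorem stmt5 (η : Polynomial ℂ) :
    (∀ x : ℂ, 5 * x * η.eval x - 4 * x * η.eval (2 * x) + x * η.eval (3 * x) = 0) ↔
      ∃ a b : ℂ, η = Polynomial.C a * Polynomial.X ^ 3 + Polynomial.C b * Polynomial.X := by
  constructor
  · intro h
    have hX : X * (C 5 * η - C 4 * η.comp (C 2 * X) + η.comp (C 3 * X)) = 0 := by
      refine Polynomial.funext fun x => ?_
      simp only [eval_mul, eval_add, eval_sub, eval_comp, eval_C, eval_X, eval_zero]
      linear_combination h x
    have hη := (mul_eq_zero.mp hX).resolve_left X_ne_zero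
    have hcoeff : ∀ n, n ≠ 1 → n ≠ 3 → η.coeff n = 0 := by
      intro n h1 h3
      have hn := congrArg (fun p => coeff p n) hη
      simp only [coeff_add, coeff_sub, coeff_C_mul, comp_C_mul_X_coeff, coeff_zero] at hn
      have hprod : η.coeff n * (5 + 3 ^ n - 4 * 2 ^ n) = 0 := by linear_combination hn
      refine (mul_eq_zero.mp hprod).resolve_right fun hz => ?_
      have hnat : 5 + 3 ^ n = 4 * 2 ^ n := by exact_mod_cast sub_eq_zero.mp hz
      exact (eq_one_or_eq_three_of_five_add_three_pow n hnat).elim h1 h3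
    refine ⟨η.coeff 3, η.coeff 1, ?_⟩
    ext n
    rw [coeff_add, coeff_C_mul_X_pow, coeff_C_mul_X]
    by_cases h1 : n = 1
    · simp [h1]
    · by_cases h3 : n = 3
      · simp [h3]
      · simp [h1, h3, hcoeff n h1 h3]
  · rintro ⟨a, b, rfl⟩ x
    simp only [eval_add, eval_mul, eval_pow, eval_C, eval_X]
    ring
end

section
/- Every continuous function η : ℝ → ℝ satisfying the functional equation 2x·η(x) − 2y·η(y) = (x − y)·η(x + y) + (x + y)·η(x − y) for all x, y ∈ ℝ is of the form η(x) = a·x³ + b·x for some constants a, b ∈ ℝ. -/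
theorem exists_cubic_on_nat (f : ℝ → ℝ)
    (hf : ∀ x y : ℝ,
      2 * x * f x - 2 * y * f y = (x - y) * f (x + y) + (x + y) * f (x - y)) :
    ∃ a b : ℝ, ∀ n : ℕ, f n = a * (n : ℝ) ^ 3 + b * n := by
  have h0 : f 0 = 0 := by
    have h := hf 1 1
    norm_num at h
    exact h
  refine ⟨(f 2 - 2 * f 1) / 6, (8 * f 1 - f 2) / 6, fun n ↦ ?_⟩
  induction n using Nat.strong_induction_on with
  | _ n ih =>
    match n with
    | 0 => simp [h0]
    | 1 => push_cast; ring
    | 2 => push_cast; ring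
    | k + 3 =>
      have h1 := ih (k + 1) (by omega)
      have h2 := ih (k + 2) (by omega)
      have h := hf (k + 2) 1
      push_cast at h1 h2 ⊢
      rw [show (k : ℝ) + 2 + 1 = k + 3 by ring, show (k : ℝ) + 2 - 1 = k + 1 by ring,
        h1, h2] at h
      have hk : (k : ℝ) + 1 ≠ 0 := by positivity
      apply mul_left_cancel₀ hk
      linear_combination -h

/-- Every continuous `η : ℝ → ℝ` satisfying
`2x·η(x) − 2y·η(y) = (x − y)·η(x + y) + (x + y)·η(x − y)` for all `x, y ∈ ℝ`
has the form `η(x) = a·x³ + b·x` for some constants `a, b ∈ ℝ`. -/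
theorem stmt6 (η : ℝ → ℝ) (hcont : Continuous η)
    (hfe : ∀ x y : ℝ,
      2 * x * η x - 2 * y * η y = (x - y) * η (x + y) + (x + y) * η (x - y)) :
    ∃ a b : ℝ, ∀ x : ℝ, η x = a * x ^ 3 + b * x := by
  obtain ⟨a, b, hab⟩ := exists_cubic_on_nat η hfe
  refine ⟨a, b, ?_⟩
  have hdiv (n m : ℕ) (hm : m ≠ 0) :
      η (n / m) = a * ((n : ℝ) / m) ^ 3 + b * (n / m) := by
    have hm' : (m : ℝ) ≠ 0 := by exact_mod_cast hm
    obtain ⟨a', b', h⟩ := exists_cubic_on_nat (fun x ↦ η (x / m)) fun x y ↦ by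
      have h := hfe (x / m) (y / m)
      rw [← add_div, ← sub_div] at h
      field_simp at h
      linear_combination h
    have h1 := h m
    have h2 := h (2 * m)
    have e1 := hab 1
    have e2 := hab 2
    push_cast at h1 h2 e1 e2
    rw [div_self hm', e1] at h1
    rw [mul_div_assoc, div_self hm', mul_one, e2] at h2
    have ha : a = a' * (m : ℝ) ^ 3 := by linear_combination (h2 - 2 * h1) / 6
    have hb : b = b' * m := by linear_combination (8 * h1 - h2) / 6
    rw [h n, ha, hb]
    field_simp
  have hodd (x : ℝ) (hx : x ≠ 0) : η (-x) = -η x := by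
    have h := hfe 0 x
    simp only [zero_add, zero_sub, mul_zero, zero_mul] at h
    apply mul_left_cancel₀ hx
    linear_combination -h
  have hrat (q : ℚ) : η q = a * (q : ℝ) ^ 3 + b * q := by
    have hpos (r : ℚ) (hr : 0 ≤ r) : η r = a * (r : ℝ) ^ 3 + b * r := by
      have h := hdiv r.num.toNat r.den r.den_nz
      have hr' : ((r.num.toNat : ℕ) : ℝ) / r.den = r := by
        rw [Rat.cast_def, ← Int.cast_natCast, Int.toNat_of_nonneg (Rat.num_nonneg.2 hr)]
      rwa [hr'] at h
    rcases le_or_gt 0 q with hq | hq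
    · exact hpos q hq
    · have h := hpos (-q) (by linarith)
      have hq' : (q : ℝ) ≠ 0 := by exact_mod_cast hq.ne
      push_cast at h
      rw [hodd _ hq'] at h
      linear_combination -h
  have heq : η = fun x ↦ a * x ^ 3 + b * x :=
    Rat.isDenseEmbedding_coe_real.dense.equalizer hcont (by fun_prop) (funext hrat)
  exact congrFun heq
end

section
/- Suppose a ∉ Γ_μ or b ∉ {0, 1}. Then the tensor field module T_μ(a,b) is an irreducible (simple) W(n)_μ-module: its only W(n)_μ-submodules are 0 and T_μ(a,b) itself. -/
/-- Underlying space of the tensor-field modules `T_μ(a,b)`: the free `ℂ`-module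
with basis `{v_β : β ∈ ℤⁿ}`. -/
abbrev Tn (n : ℕ) := Zn n →₀ ℂ

/-- The basis vector `v_β` of `T_μ(a,b)`. -/
noncomputable def vv {n : ℕ} (β : Zn n) : Tn n := Finsupp.single β 1

theorem mdot_zero {n : ℕ} (μ : Fin n → ℂ) : mdot μ 0 = 0 := by
  simp [mdot]

theorem Generic.injective {n : ℕ} {μ : Fin n → ℂ} (hμ : Generic μ) :
    Function.Injective (mdot μ) := by
  intro α β h
  by_contra hne
  exact hμ (α - β) (sub_ne_zero.mpr hne) (by rw [mdot_sub, h, sub_self])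

/-- A nonzero subspace of finitely supported functions that is stable under a diagonal operator
with distinct eigenvalues contains a basis vector. -/
theorem exists_single_mem_of_diagonal {ι K : Type*} [Field K] {c : ι → K}
    (hc : Function.Injective c) (D : (ι →₀ K) →ₗ[K] ι →₀ K) (hD : ∀ w i, D w i = c i * w i)
    {U : Submodule K (ι →₀ K)} (hU : ∀ w ∈ U, D w ∈ U) (hne : U ≠ ⊥) :
    ∃ i, Finsupp.single i 1 ∈ U := by
  classical
  obtain ⟨w, hw, hw0⟩ := U.ne_bot_iff.mp hne
  induction hk : w.support.card using Nat.strong_induction_on generalizing w with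
  | _ k ih =>
    obtain ⟨i, hi⟩ := Finsupp.support_nonempty_iff.mpr hw0
    by_cases h : ∃ j ∈ w.support, j ≠ i
    · obtain ⟨j, hj, hji⟩ := h
      have hval : ∀ l, (D w - c i • w) l = (c l - c i) * w l := by
        intro l
        simp [hD, sub_mul]
      refine ih _ ?_ (D w - c i • w) (U.sub_mem (hU w hw) (U.smul_mem _ hw)) ?_ rfl
      · rw [← hk]
        refine Finset.card_lt_card (Finset.ssubset_iff_of_subset ?_ |>.mpr ⟨i, hi, ?_⟩)
        · intro l hl
          rw [Finsupp.mem_support_iff, hval] at hl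
          exact Finsupp.mem_support_iff.mpr (right_ne_zero_of_mul hl)
        · simp [hD]
      · intro h0
        have := hval j
        rw [h0, Finsupp.zero_apply, eq_comm, mul_eq_zero, sub_eq_zero] at this
        exact this.elim (fun h => hji (hc h)) (Finsupp.mem_support_iff.mp hj)
    · push Not at h
      refine ⟨i, ?_⟩
      have hwi : w = Finsupp.single i (w i) :=
        Finsupp.support_subset_singleton.mp fun l hl => Finset.mem_singleton.mpr (h l hl)
      have hsm : Finsupp.single i (1 : K) = (w i)⁻¹ • w := by
        rw [hwi, Finsupp.smul_single]
        simp [inv_mul_cancel₀ (Finsupp.mem_support_iff.mp hi)]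
      rw [hsm]
      exact U.smul_mem _ hw

/-- If `a ∉ Γ_μ` or `b ∉ {0,1}`, then the tensor field module `T_μ(a,b)`
(action `e_α · v_β = (a + μ·β + b·(μ·α))·v_{α+β}`) is an irreducible
`W(n)_μ`-module: its only submodules are `0` and the whole module. -/
theorem stmt8 (n : ℕ) (hn : 1 ≤ n) (μ : Fin n → ℂ) (hμ : Generic μ) (a b : ℂ)
    (hab : a ∉ Set.range (mdot μ) ∨ (b ≠ 0 ∧ b ≠ 1))
    (ρ : Wn n →ₗ[ℂ] Tn n →ₗ[ℂ] Tn n)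
    (hρ : ∀ α β : Zn n, ρ (ew α) (vv β) = (a + mdot μ β + b * mdot μ α) • vv (α + β)) :
    ∀ U : Submodule ℂ (Tn n), (∀ (x : Wn n), ∀ w ∈ U, ρ x w ∈ U) → U = ⊥ ∨ U = ⊤ := by
  have hinj := hμ.injective
  intro U hU
  refine or_iff_not_imp_left.mpr fun hne => ?_
  have hD : ∀ (w : Tn n) (γ : Zn n), ρ (ew 0) w γ = (a + mdot μ γ) * w γ := by
    classical
    intro w γ
    induction w using Finsupp.induction_linear with
    | zero => simp
    | add f g hf hg => rw [map_add, Finsupp.add_apply, hf, hg, Finsupp.add_apply, mul_add]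
    | single β r =>
      have hr : (Finsupp.single β r : Tn n) = r • vv β := by simp [vv]
      rw [hr, map_smul, hρ, mdot_zero, zero_add]
      by_cases h : β = γ
      · subst h
        simp only [vv, Finsupp.smul_apply, Finsupp.single_eq_same, smul_eq_mul]
        ring
      · simp [vv, h]
  obtain ⟨β, hβ⟩ : ∃ β : Zn n, vv β ∈ U :=
    exists_single_mem_of_diagonal (c := fun γ => a + mdot μ γ)
      (fun γ δ h => hinj (add_left_cancel h)) (ρ (ew 0)) hD (hU _) hne
  have step : ∀ γ δ : Zn n, vv γ ∈ U →
      (1 - b) * (a + mdot μ γ) + b * (a + mdot μ δ) ≠ 0 → vv δ ∈ U := by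
    intro γ δ hγ hc
    have h := hU (ew (δ - γ)) _ hγ
    rw [hρ, sub_add_cancel, mdot_sub] at h
    refine (U.smul_mem_iff fun h0 => hc ?_).mp h
    linear_combination h0
  have all : ∀ γ : Zn n, vv γ ∈ U := by
    intro γ
    by_cases hb : b ≠ 0 ∧ b ≠ 1
    · obtain ⟨hb0, hb1⟩ := hb
      have : Nonempty (Fin n) := ⟨⟨0, hn⟩⟩
      have hb1' : 1 - b ≠ 0 := sub_ne_zero.mpr hb1.symm
      have hfin : ({δ : Zn n | (1 - b) * (a + mdot μ β) + b * (a + mdot μ δ) = 0} ∪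
          {δ : Zn n | (1 - b) * (a + mdot μ δ) + b * (a + mdot μ γ) = 0}).Finite := by
        refine (Set.Subsingleton.finite ?_).union (Set.Subsingleton.finite ?_)
        · intro δ hδ ε hε
          simp only [Set.mem_ofPred_eq] at hδ hε
          exact hinj (mul_left_cancel₀ hb0 (by linear_combination hδ - hε))
        · intro δ hδ ε hε
          simp only [Set.mem_ofPred_eq] at hδ hε
          exact hinj (mul_left_cancel₀ hb1' (by linear_combination hδ - hε))
      obtain ⟨δ, hδ⟩ := hfin.exists_notMem
      simp only [Set.mem_union, Set.mem_ofPred_eq, not_or] at hδ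
      exact step δ γ (step β δ hβ hδ.1) hδ.2
    · have ha := hab.resolve_right hb
      have hne0 : ∀ δ : Zn n, a + mdot μ δ ≠ 0 := by
        intro δ h
        refine ha ⟨0 - δ, ?_⟩
        rw [mdot_sub, mdot_zero]
        linear_combination -h
      refine step β γ hβ ?_
      by_cases hb0 : b = 0
      · simpa [hb0] using hne0 β
      · have hb1 : b = 1 := by
          by_contra hb1
          exact hb ⟨hb0, hb1⟩
        simpa [hb1] using hne0 γ
  rw [eq_top_iff]
  intro w _
  induction w using Finsupp.induction_linear with
  | zero => exact U.zero_mem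
  | add f g hf hg => exact U.add_mem (hf trivial) (hg trivial)
  | single γ r =>
    have hr : (Finsupp.single γ r : Tn n) = r • vv γ := by simp [vv]
    rw [hr]
    exact U.smul_mem r (all γ)
end

section
/- Let V be a nonzero irreducible Vir(n)_μ-module that is cuspidal, i.e. V is the direct sum of the eigenspaces V_λ = {v ∈ V : e_0·v = λv} (λ ∈ ℂ) of e_0 and there is a constant N with dim V_λ ≤ N for all λ. Then the central element c_μ acts trivially on V: c_μ·v = 0 for all v ∈ V. -/
open Filter Topology

/-- A discrete Grönwall bound: a nonnegative sequence whose growth is controlled by a summable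
sequence is bounded. -/
theorem bounded_of_summable_growth (a δ : ℕ → ℝ) (ha : ∀ k, 0 ≤ a k) (hδ : ∀ k, 0 ≤ δ k)
    (hs : Summable δ) (h : ∀ k, a (k + 1) * (1 - δ k) ≤ a k * (1 + δ k) + δ k) :
    ∃ K, ∀ k, a k ≤ K := by
  obtain ⟨k₀, hk₀⟩ := eventually_atTop.1
    (hs.tendsto_atTop_zero.eventually (ge_mem_nhds (show (0 : ℝ) < 1 / 2 by norm_num)))
  have step : ∀ k, k₀ ≤ k → a (k + 1) + 1 ≤ (a k + 1) * Real.exp (4 * δ k) := by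
    intro k hk
    have h1 := hk₀ k hk
    have h2 : a (k + 1) + 1 ≤ (a k + 1) * (1 + 4 * δ k) := by
      nlinarith [h k, ha k, ha (k + 1), hδ k, mul_nonneg (ha k) (hδ k),
        mul_nonneg (mul_nonneg (ha k) (hδ k)) (sub_nonneg.2 h1),
        mul_nonneg (hδ k) (sub_nonneg.2 h1)]
    refine h2.trans (mul_le_mul_of_nonneg_left ?_ (by linarith [ha k]))
    linarith [Real.add_one_le_exp (4 * δ k)]
  have bound : ∀ i, a (k₀ + i) + 1 ≤
      (a k₀ + 1) * Real.exp (4 * ∑ t ∈ Finset.range i, δ (k₀ + t)) := by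
    intro i
    induction i with
    | zero => simp
    | succ i ih =>
      rw [Finset.sum_range_succ, mul_add, Real.exp_add, ← mul_assoc, ← add_assoc]
      exact (step _ (by omega)).trans (mul_le_mul_of_nonneg_right ih (Real.exp_pos _).le)
  have hs' : Summable fun t => δ (k₀ + t) := by
    simpa [add_comm] using (summable_nat_add_iff k₀).2 hs
  have tail : ∀ i, a (k₀ + i) ≤ (a k₀ + 1) * Real.exp (4 * ∑' t, δ (k₀ + t)) := by
    intro i
    have h1 := hs'.sum_le_tsum (Finset.range i) (fun t _ => hδ _)
    have h2 : Real.exp (4 * ∑ t ∈ Finset.range i, δ (k₀ + t)) ≤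
        Real.exp (4 * ∑' t, δ (k₀ + t)) := Real.exp_le_exp.2 (by linarith)
    have h3 := mul_le_mul_of_nonneg_left h2 (show 0 ≤ a k₀ + 1 by linarith [ha k₀])
    linarith [bound i]
  refine ⟨∑ i ∈ Finset.range k₀, a i + (a k₀ + 1) * Real.exp (4 * ∑' t, δ (k₀ + t)), fun k => ?_⟩
  have hpos : 0 ≤ (a k₀ + 1) * Real.exp (4 * ∑' t, δ (k₀ + t)) :=
    mul_nonneg (by linarith [ha k₀]) (Real.exp_pos _).le
  rcases lt_or_ge k k₀ with hk | hk
  · linarith [Finset.single_le_sum (fun i _ => ha i) (Finset.mem_range.2 hk)]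
  · have := tail (k - k₀)
    rw [Nat.add_sub_cancel' hk] at this
    linarith [Finset.sum_nonneg (fun i (_ : i ∈ Finset.range k₀) => ha i)]

section NormedAlgebra

variable {A : Type*} [NormedRing A] [NormedAlgebra ℂ A]

/-- Approximate solution of the commutation relation with `e_1` satisfied by `e_{-2}`. -/
noncomputable def approxLowering (C : A) (u : ℂ) : A := u⁻¹ • 1 - (u⁻¹ ^ 3) • C

theorem approxLowering_recurrence (C : A) (u : ℂ) (h0 : u ≠ 0) (h1 : u + 1 ≠ 0) :
    ((u * (u - 1)) • 1 - C) * approxLowering C u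
      - approxLowering C (u + 1) * (((u + 1) * (u + 2)) • 1 - C) + (3 : ℂ) • 1 =
    (u⁻¹ * (u + 1)⁻¹) • (((u⁻¹ * (u + 1)⁻¹) • C) +
      ((u⁻¹ * (u + 1)⁻¹) * (3 + u⁻¹ * (u + 1)⁻¹)) • (C * C)) := by
  simp only [approxLowering, mul_sub, sub_mul, smul_mul_assoc, mul_smul_comm, one_mul, mul_one]
  match_scalars <;> field_simp <;> ring

theorem approxLowering_commutator (C B₀ : A) (u : ℂ) (h0 : u ≠ 0) (h2 : u + 2 ≠ 0) :
    ((u * (u ^ 2 - 1)) • 1 - (3 * u) • C + B₀) * approxLowering C u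
      - approxLowering C (u + 2) *
        (((u + 2) * ((u + 2) ^ 2 - 1)) • 1 - (3 * (u + 2)) • C + B₀) + (4 * (u + 1)) • 1 =
    (u⁻¹ ^ 2 - (u + 2)⁻¹ ^ 2) • (C + (3 : ℂ) • (C * C)) +
      (B₀ * approxLowering C u - approxLowering C (u + 2) * B₀) := by
  simp only [approxLowering, mul_sub, sub_mul, mul_add, add_mul, smul_mul_assoc, mul_smul_comm,
    one_mul, mul_one]
  match_scalars <;> field_simp <;> ring

theorem tendsto_approxLowering {u : ℕ → ℂ} (hu : Tendsto (fun k => (u k)⁻¹) atTop (𝓝 0)) (C : A) :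
    Tendsto (fun k => approxLowering C (u k)) atTop (𝓝 0) := by
  have := (hu.smul_const (1 : A)).sub ((hu.pow 3).smul_const C)
  simpa [approxLowering] using this

/-- The recurrence satisfied by the rescaled deviation from `approxLowering`. -/
theorem lowering_deviation_recurrence (C x x' : A) (v : ℂ) (h0 : v ≠ 0) (h1 : v + 1 ≠ 0)
    (h2 : v + 2 ≠ 0) (hm : v - 1 ≠ 0)
    (hx : ((v * (v - 1)) • 1 - C) * x - x' * (((v + 1) * (v + 2)) • 1 - C) = -((3 : ℂ) • 1)) :
    ((v + 1) ^ 2 * ((v + 1) ^ 2 - 1)) • (x' - approxLowering C (v + 1)) =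
      (v ^ 2 * (v ^ 2 - 1)) • (x - approxLowering C v)
      - (v⁻¹ * (v - 1)⁻¹) • (C * ((v ^ 2 * (v ^ 2 - 1)) • (x - approxLowering C v)))
      + ((v + 1)⁻¹ * (v + 2)⁻¹) •
        ((((v + 1) ^ 2 * ((v + 1) ^ 2 - 1)) • (x' - approxLowering C (v + 1))) * C)
      + ((v⁻¹ * (v + 1)⁻¹) • C +
        ((v⁻¹ * (v + 1)⁻¹) * (3 + v⁻¹ * (v + 1)⁻¹)) • (C * C)) := by
  have e1 := approxLowering_recurrence C v h0 h1
  generalize (v⁻¹ * (v + 1)⁻¹) • C +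
    ((v⁻¹ * (v + 1)⁻¹) * (3 + v⁻¹ * (v + 1)⁻¹)) • (C * C) = R at *
  have e3 : ((v * (v - 1)) • 1 - C) * (x - approxLowering C v)
      - (x' - approxLowering C (v + 1)) * (((v + 1) * (v + 2)) • 1 - C) =
        -((v⁻¹ * (v + 1)⁻¹) • R) := by
    rw [← e1]
    generalize (v * (v - 1)) • (1 : A) - C = M at *
    generalize ((v + 1) * (v + 2)) • (1 : A) - C = M' at *
    rw [← sub_eq_zero, sub_neg_eq_add] at hx
    rw [eq_neg_iff_add_eq_zero, ← hx, mul_sub, sub_mul]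
    abel
  generalize x - approxLowering C v = y at *
  generalize x' - approxLowering C (v + 1) = y' at *
  have e4 : R = -((v * (v + 1)) • (((v * (v - 1)) • 1 - C) * y
      - y' * (((v + 1) * (v + 2)) • 1 - C))) := by
    rw [e3, smul_neg, neg_neg, smul_smul, show v * (v + 1) * (v⁻¹ * (v + 1)⁻¹) = 1 by field_simp,
      one_smul]
  rw [e4]
  simp only [mul_sub, sub_mul, smul_mul_assoc, mul_smul_comm, one_mul, mul_one]
  match_scalars <;> field_simp <;> ring

/-- The deviation from `approxLowering` of an exact solution decays like `u⁻⁴`. -/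
theorem lowering_deviation_bounded (C : A) (u : ℕ → ℂ) (hu : ∀ k, u (k + 1) = u k + 1)
    (hlow : ∀ k : ℕ, (k : ℝ) + 2 ≤ ‖u k‖) (X : ℕ → A)
    (hX : ∀ k, ((u k * (u k - 1)) • 1 - C) * X k
      - X (k + 1) * (((u k + 1) * (u k + 2)) • 1 - C) = -((3 : ℂ) • 1)) :
    ∃ K, ∀ k, ‖(u k ^ 2 * (u k ^ 2 - 1)) • (X k - approxLowering C (u k))‖ ≤ K := by
  have hu2 : ∀ k, u (k + 2) = u k + 2 := fun k => by
    rw [show k + 2 = k + 1 + 1 from rfl, hu, hu, add_assoc, one_add_one_eq_two]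
  have n0 : ∀ k, u k ≠ 0 := fun k h => by
    have := hlow k
    rw [h, norm_zero] at this
    linarith [(Nat.cast_nonneg k : (0 : ℝ) ≤ k)]
  have lowm : ∀ k : ℕ, (k : ℝ) + 1 ≤ ‖u k - 1‖ := fun k => by
    have := norm_sub_norm_le (u k) 1
    rw [norm_one] at this
    linarith [hlow k]
  have nm : ∀ k, u k - 1 ≠ 0 := fun k h => by
    have := lowm k
    rw [h, norm_zero] at this
    linarith [(Nat.cast_nonneg k : (0 : ℝ) ≤ k)]
  have low1 : ∀ k : ℕ, (k : ℝ) + 1 ≤ ‖u k + 1‖ := fun k => by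
    have := hlow (k + 1)
    rw [hu] at this
    push_cast at this
    linarith
  have low2 : ∀ k : ℕ, (k : ℝ) + 1 ≤ ‖u k + 2‖ := fun k => by
    have := hlow (k + 2)
    rw [hu2] at this
    push_cast at this
    linarith
  have n1 : ∀ k, u k + 1 ≠ 0 := fun k => hu k ▸ n0 (k + 1)
  have n2 : ∀ k, u k + 2 ≠ 0 := fun k => hu2 k ▸ n0 (k + 2)
  obtain ⟨r, hr⟩ : ∃ r : ℕ → ℝ, r = fun k : ℕ => 1 / ((k : ℝ) + 1) ^ 2 := ⟨_, rfl⟩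
  have r0 : ∀ k, 0 ≤ r k := fun k => by rw [hr]; positivity
  have r1 : ∀ k, r k ≤ 1 := fun k => by
    rw [hr]
    refine div_le_one_of_le₀ ?_ (by positivity)
    nlinarith [(Nat.cast_nonneg k : (0 : ℝ) ≤ k)]
  have hrs : Summable r := by
    have := (summable_nat_add_iff 1).2 (Real.summable_one_div_nat_pow.2 one_lt_two)
    simpa [hr] using this
  have inv_le : ∀ (k : ℕ) (a b : ℂ), (k : ℝ) + 1 ≤ ‖a‖ → (k : ℝ) + 1 ≤ ‖b‖ →
      ‖a⁻¹ * b⁻¹‖ ≤ r k := by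
    intro k a b ha hb
    have hk : (0 : ℝ) < (k : ℝ) + 1 := by positivity
    rw [← mul_inv, norm_inv, norm_mul, hr, ← one_div]
    refine one_div_le_one_div_of_le (by positivity) ?_
    rw [sq]
    exact mul_le_mul ha hb hk.le (hk.le.trans ha)
  obtain ⟨Z, hZ⟩ : ∃ Z : ℕ → A, ∀ k, (u k ^ 2 * (u k ^ 2 - 1)) •
      (X k - approxLowering C (u k)) = Z k := ⟨_, fun _ => rfl⟩
  simp only [hZ]
  have key : ∀ k, Z (k + 1) = Z k - ((u k)⁻¹ * (u k - 1)⁻¹) • (C * Z k)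
      + ((u k + 1)⁻¹ * (u k + 2)⁻¹) • (Z (k + 1) * C)
      + (((u k)⁻¹ * (u k + 1)⁻¹) • C + (((u k)⁻¹ * (u k + 1)⁻¹) *
        (3 + (u k)⁻¹ * (u k + 1)⁻¹)) • (C * C)) := by
    intro k
    have := lowering_deviation_recurrence C (X k) (X (k + 1)) (u k) (n0 k) (n1 k) (n2 k) (nm k)
      (hX k)
    rwa [← hu k, hZ, hZ, hu k] at this
  have growth : ∀ k, ‖Z (k + 1)‖ * (1 - r k * (‖C‖ + 4 * ‖C‖ ^ 2)) ≤
      ‖Z k‖ * (1 + r k * (‖C‖ + 4 * ‖C‖ ^ 2)) + r k * (‖C‖ + 4 * ‖C‖ ^ 2) := by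
    intro k
    have b1 := inv_le k (u k) (u k - 1) (by linarith [hlow k]) (lowm k)
    have b2 := inv_le k (u k + 1) (u k + 2) (low1 k) (low2 k)
    have b3 := inv_le k (u k) (u k + 1) (by linarith [hlow k]) (low1 k)
    have c1 : ‖((u k)⁻¹ * (u k - 1)⁻¹) • (C * Z k)‖ ≤ r k * (‖C‖ * ‖Z k‖) := by
      rw [norm_smul]
      exact mul_le_mul b1 (norm_mul_le _ _) (norm_nonneg _) (r0 k)
    have c2 : ‖((u k + 1)⁻¹ * (u k + 2)⁻¹) • (Z (k + 1) * C)‖ ≤ r k * (‖Z (k + 1)‖ * ‖C‖) := by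
      rw [norm_smul]
      exact mul_le_mul b2 (norm_mul_le _ _) (norm_nonneg _) (r0 k)
    have c3 : ‖((u k)⁻¹ * (u k + 1)⁻¹) • C‖ ≤ r k * ‖C‖ := by
      rw [norm_smul]
      exact mul_le_mul_of_nonneg_right b3 (norm_nonneg _)
    have c4 : ‖(((u k)⁻¹ * (u k + 1)⁻¹) * (3 + (u k)⁻¹ * (u k + 1)⁻¹)) • (C * C)‖ ≤
        r k * 4 * ‖C‖ ^ 2 := by
      rw [norm_smul, norm_mul, sq]
      refine mul_le_mul (mul_le_mul b3 ?_ (norm_nonneg _) (r0 k)) (norm_mul_le _ _)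
        (norm_nonneg _) (mul_nonneg (r0 k) (by norm_num))
      refine (norm_add_le _ _).trans ?_
      have : ‖(3 : ℂ)‖ = 3 := by simp
      linarith [r1 k]
    have tri : ‖Z (k + 1)‖ ≤ ‖Z k‖ + r k * (‖C‖ * ‖Z k‖) + r k * (‖Z (k + 1)‖ * ‖C‖)
        + (r k * ‖C‖ + r k * 4 * ‖C‖ ^ 2) := by
      conv_lhs => rw [key k]
      refine (norm_add_le _ _).trans (add_le_add ?_ ?_)
      · refine (norm_add_le _ _).trans (add_le_add ?_ c2)
        exact (norm_sub_le _ _).trans (add_le_add le_rfl c1)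
      · exact (norm_add_le _ _).trans (add_le_add c3 c4)
    have p1 : 0 ≤ r k * (4 * ‖C‖ ^ 2) * ‖Z k‖ :=
      mul_nonneg (mul_nonneg (r0 k) (by positivity)) (norm_nonneg _)
    have p2 : 0 ≤ r k * (4 * ‖C‖ ^ 2) * ‖Z (k + 1)‖ :=
      mul_nonneg (mul_nonneg (r0 k) (by positivity)) (norm_nonneg _)
    linarith [tri, p1, p2]
  have hc : 0 ≤ ‖C‖ + 4 * ‖C‖ ^ 2 := by positivity
  generalize ‖C‖ + 4 * ‖C‖ ^ 2 = c at *
  exact bounded_of_summable_growth (fun k => ‖Z k‖) (fun k => r k * c) (fun k => norm_nonneg _)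
    (fun k => mul_nonneg (r0 k) hc) (hrs.mul_right c) growth

theorem central_term_eq_zero_of_norm_ge [Nontrivial A] (C B₀ : A) (z : ℂ) (u : ℕ → ℂ)
    (hu : ∀ k, u (k + 1) = u k + 1)
    (hlow : ∀ k : ℕ, (k : ℝ) + 2 ≤ ‖u k‖) (X : ℕ → A)
    (hX : ∀ k, ((u k * (u k - 1)) • 1 - C) * X k
      - X (k + 1) * (((u k + 1) * (u k + 2)) • 1 - C) = -((3 : ℂ) • 1))
    (hB : ∀ k, ((u k * (u k ^ 2 - 1)) • 1 - (3 * u k) • C + B₀) * X k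
      - X (k + 2) * (((u k + 2) * ((u k + 2) ^ 2 - 1)) • 1 - (3 * (u k + 2)) • C + B₀) =
        (-4 * (u k + 1) + z) • 1) : z = 0 := by
  obtain ⟨K, hK⟩ := lowering_deviation_bounded C u hu hlow X hX
  have hu2 : ∀ k, u (k + 2) = u k + 2 := fun k => by
    rw [show k + 2 = k + 1 + 1 from rfl, hu, hu, add_assoc, one_add_one_eq_two]
  have n0 : ∀ k, u k ≠ 0 := fun k h => by
    have := hlow k
    rw [h, norm_zero] at this
    linarith [(Nat.cast_nonneg k : (0 : ℝ) ≤ k)]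
  have nsq : ∀ k, 1 - (u k)⁻¹ ^ 2 ≠ 0 := fun k h => by
    have h1 : (u k)⁻¹ ^ 2 = 1 := (sub_eq_zero.1 h).symm
    have h2 : ‖u k‖ ^ 2 = 1 := by
      rw [inv_pow, inv_eq_one] at h1
      rw [← norm_pow, h1, norm_one]
    nlinarith [hlow k, (Nat.cast_nonneg k : (0 : ℝ) ≤ k)]
  have tinv : Tendsto (fun k => (u k)⁻¹) atTop (𝓝 0) := by
    refine tendsto_inv₀_cobounded.comp (tendsto_norm_atTop_iff_cobounded.1 ?_)
    exact tendsto_atTop_mono (fun k => (by linarith [hlow k] : (k : ℝ) ≤ ‖u k‖))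
      tendsto_natCast_atTop_atTop
  have tinv2 : Tendsto (fun k => (u (k + 2))⁻¹) atTop (𝓝 0) :=
    tinv.comp (tendsto_add_atTop_nat 2)
  set Y : ℕ → A := fun k => X k - approxLowering C (u k) with hY
  have tY : Tendsto (fun k => (u k ^ 3) • Y k) atTop (𝓝 0) := by
    have h1 : Tendsto (fun k => (u k)⁻¹ * (1 - (u k)⁻¹ ^ 2)⁻¹) atTop (𝓝 0) := by
      have h2 : Tendsto (fun k => 1 - (u k)⁻¹ ^ 2) atTop (𝓝 1) := by
        simpa using (tinv.pow 2).const_sub 1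
      simpa using tinv.mul (h2.inv₀ one_ne_zero)
    have h3 : Tendsto (fun k => ((u k)⁻¹ * (1 - (u k)⁻¹ ^ 2)⁻¹) •
        ((u k ^ 2 * (u k ^ 2 - 1)) • Y k)) atTop (𝓝 0) :=
      h1.zero_smul_isBoundedUnder_le (isBoundedUnder_of ⟨K, hK⟩)
    refine h3.congr fun k => ?_
    rw [smul_smul]
    congr 1
    have a := n0 k
    have b : u k ^ 2 - 1 ≠ 0 := fun h => nsq k (by rw [inv_pow, sub_eq_zero.1 h]; norm_num)
    field_simp
  have tB : Tendsto (fun k => (1 - (u k)⁻¹ ^ 2) • (1 : A) - (3 * (u k)⁻¹ ^ 2) • C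
      + ((u k)⁻¹ ^ 3) • B₀) atTop (𝓝 1) := by
    have := ((((tinv.pow 2).const_sub 1).smul_const (1 : A)).sub
      (((tinv.pow 2).const_mul 3).smul_const C)).add ((tinv.pow 3).smul_const B₀)
    simpa using this
  have e1 : ∀ k, (u k * (u k ^ 2 - 1)) • (1 : A) - (3 * u k) • C + B₀ = (u k ^ 3) •
      ((1 - (u k)⁻¹ ^ 2) • (1 : A) - (3 * (u k)⁻¹ ^ 2) • C + ((u k)⁻¹ ^ 3) • B₀) := by
    intro k
    have a := n0 k
    match_scalars <;> field_simp
  have tBY : Tendsto (fun k => ((u k * (u k ^ 2 - 1)) • (1 : A) - (3 * u k) • C + B₀) * Y k)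
      atTop (𝓝 0) := by
    have := tB.mul tY
    rw [one_mul] at this
    refine this.congr fun k => ?_
    rw [e1, mul_smul_comm, smul_mul_assoc]
  have tYB : Tendsto (fun k => Y k * ((u k * (u k ^ 2 - 1)) • (1 : A) - (3 * u k) • C + B₀))
      atTop (𝓝 0) := by
    have := tY.mul tB
    rw [zero_mul] at this
    refine this.congr fun k => ?_
    rw [e1, mul_smul_comm, smul_mul_assoc]
  have tP := tendsto_approxLowering tinv C
  have tP2 := tendsto_approxLowering tinv2 C
  have tA : Tendsto (fun k => ((u k)⁻¹ ^ 2 - (u (k + 2))⁻¹ ^ 2) • (C + (3 : ℂ) • (C * C)) +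
      (B₀ * approxLowering C (u k) - approxLowering C (u (k + 2)) * B₀)) atTop (𝓝 0) := by
    have := (((tinv.pow 2).sub (tinv2.pow 2)).smul_const (C + (3 : ℂ) • (C * C))).add
      ((tP.const_mul B₀).sub (tP2.mul_const B₀))
    simpa using this
  have tot := tA.add (tBY.sub (tYB.comp (tendsto_add_atTop_nat 2)))
  have hconst : (fun k => (((u k)⁻¹ ^ 2 - (u (k + 2))⁻¹ ^ 2) • (C + (3 : ℂ) • (C * C)) +
      (B₀ * approxLowering C (u k) - approxLowering C (u (k + 2)) * B₀)) +
      (((u k * (u k ^ 2 - 1)) • (1 : A) - (3 * u k) • C + B₀) * Y k -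
        ((fun k => Y k * ((u k * (u k ^ 2 - 1)) • (1 : A) - (3 * u k) • C + B₀)) ∘
          fun k => k + 2) k)) = fun _ => z • (1 : A) := by
    funext k
    have e2 := approxLowering_commutator C B₀ (u k) (n0 k) (hu2 k ▸ n0 (k + 2))
    have e3 := hB k
    simp only [Function.comp, hY]
    rw [hu2, ← e2]
    rw [show (z • (1 : A)) = (-4 * (u k + 1) + z) • 1 + (4 * (u k + 1)) • (1 : A) by
      rw [← add_smul]; congr 1; ring, ← e3]
    generalize (u k * (u k ^ 2 - 1)) • (1 : A) - (3 * u k) • C + B₀ = M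
    generalize ((u k + 2) * ((u k + 2) ^ 2 - 1)) • (1 : A) - (3 * (u k + 2)) • C + B₀ = M'
    rw [mul_sub, sub_mul]
    abel
  rw [hconst] at tot
  have h0 : z • (1 : A) = 0 := by
    simpa using tendsto_nhds_unique tendsto_const_nhds tot
  exact (smul_eq_zero.1 h0).resolve_right one_ne_zero

/-- Asymptotic rigidity: the matrix relations satisfied by `e_1`, `e_2`, `e_{-2}` (once `e_{-1}`
has been used to identify all weight spaces) force the central term to vanish. -/
theorem central_term_eq_zero [Nontrivial A] (C B₀ : A) (z : ℂ) (u : ℕ → ℂ)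
    (hu : ∀ k, u (k + 1) = u k + 1) (X : ℕ → A)
    (hX : ∀ k, ((u k * (u k - 1)) • 1 - C) * X k
      - X (k + 1) * (((u k + 1) * (u k + 2)) • 1 - C) = -((3 : ℂ) • 1))
    (hB : ∀ k, ((u k * (u k ^ 2 - 1)) • 1 - (3 * u k) • C + B₀) * X k
      - X (k + 2) * (((u k + 2) * ((u k + 2) ^ 2 - 1)) • 1 - (3 * (u k + 2)) • C + B₀) =
        (-4 * (u k + 1) + z) • 1) : z = 0 := by
  have huk : ∀ k : ℕ, u k = u 0 + k := fun k => by
    induction k with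
    | zero => simp
    | succ k ih => rw [hu, ih]; push_cast; ring
  obtain ⟨s, hs⟩ := exists_nat_ge (‖u 0‖ + 2)
  refine central_term_eq_zero_of_norm_ge C B₀ z (fun k => u (k + s)) (fun k => ?_) (fun k => ?_)
    (fun k => X (k + s)) (fun k => ?_) (fun k => ?_)
  · show u (k + 1 + s) = u (k + s) + 1
    rw [← hu, add_right_comm]
  · show (k : ℝ) + 2 ≤ ‖u (k + s)‖
    have h1 := norm_sub_norm_le ((k + s : ℕ) : ℂ) (-u 0)
    rw [norm_neg, Complex.norm_natCast, sub_neg_eq_add, add_comm _ (u 0), ← huk] at h1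
    push_cast at h1
    linarith
  · show _ * X (k + s) - X (k + 1 + s) * _ = _
    rw [add_right_comm]
    exact hX (k + s)
  · show _ * X (k + s) - X (k + 2 + s) * _ = _
    rw [add_right_comm]
    exact hB (k + s)

end NormedAlgebra

section WeightSpaces

variable {V : Type*} [AddCommGroup V] [Module ℂ V]

theorem central_term_eq_zero_of_finiteDimensional {E : Type*} [AddCommGroup E] [Module ℂ E]
    [FiniteDimensional ℂ E] [Nontrivial E] (C B₀ : Module.End ℂ E) (z : ℂ) (u : ℕ → ℂ)
    (hu : ∀ k, u (k + 1) = u k + 1) (X : ℕ → Module.End ℂ E)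
    (hX : ∀ k, ((u k * (u k - 1)) • 1 - C) * X k
      - X (k + 1) * (((u k + 1) * (u k + 2)) • 1 - C) = -((3 : ℂ) • 1))
    (hB : ∀ k, ((u k * (u k ^ 2 - 1)) • 1 - (3 * u k) • C + B₀) * X k
      - X (k + 2) * (((u k + 2) * ((u k + 2) ^ 2 - 1)) • 1 - (3 * (u k + 2)) • C + B₀) =
        (-4 * (u k + 1) + z) • 1) : z = 0 := by
  let := Matrix.linftyOpNormedRing (n := Fin (Module.finrank ℂ E)) (α := ℂ)
  let := Matrix.linftyOpNormedAlgebra (R := ℂ) (n := Fin (Module.finrank ℂ E)) (α := ℂ)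
  have : Nonempty (Fin (Module.finrank ℂ E)) := ⟨⟨0, Module.finrank_pos⟩⟩
  let Φ := LinearMap.toMatrixAlgEquiv (Module.finBasis ℂ E)
  refine central_term_eq_zero (Φ C) (Φ B₀) z u hu (fun k => Φ (X k)) (fun k => ?_) (fun k => ?_)
  · simpa only [map_sub, map_mul, map_smul, map_one, map_neg] using congrArg Φ (hX k)
  · simpa only [map_sub, map_add, map_mul, map_smul, map_one] using congrArg Φ (hB k)

variable (L : ℤ → Module.End ℂ V) (W : ℤ → Submodule ℂ V) (x₀ z : ℂ)

theorem raise_pow_mem (hL : ∀ k j, ∀ w ∈ W j, L k w ∈ W (j + k)) {j : ℤ} {w : V} (hw : w ∈ W j)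
    (i : ℕ) : (L 1 ^ i) w ∈ W (j + i) := by
  induction i with
  | zero => simpa using hw
  | succ i ih =>
    rw [pow_succ', Module.End.mul_apply, Nat.cast_succ, ← add_assoc]
    exact hL 1 _ _ ih

theorem lower_raise_pow (hL : ∀ k j, ∀ w ∈ W j, L k w ∈ W (j + k))
    (h11 : ∀ j : ℤ, ∀ w ∈ W j, L (-1) (L 1 w) - L 1 (L (-1) w) = (2 * (x₀ + j)) • w)
    {j : ℤ} {w : V} (hw : w ∈ W j) (h0 : L (-1) w = 0) (i : ℕ) :
    L (-1) ((L 1 ^ (i + 1)) w) = ((i + 1) * (2 * (x₀ + j) + i)) • (L 1 ^ i) w := by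
  induction i with
  | zero =>
    have := h11 j w hw
    rw [h0, map_zero, sub_zero] at this
    simpa using this
  | succ i ih =>
    have := h11 _ _ (raise_pow_mem L W hL hw (i + 1))
    rw [ih, map_smul, ← Module.End.mul_apply (L 1) (L 1 ^ i), ← pow_succ', sub_eq_iff_eq_add,
      ← add_smul, ← Module.End.mul_apply (L 1), ← pow_succ'] at this
    rw [this]
    congr 1
    push_cast
    ring

/-- Lowest weight vectors of the `sl₂` spanned by `L 1`, `L 0`, `L (-1)` occur in only finitely many
weight spaces of large index. -/
theorem exists_lower_injective [∀ j, FiniteDimensional ℂ (W j)] (N : ℕ)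
    (hN : ∀ j, Module.finrank ℂ (W j) ≤ N)
    (hL : ∀ k j, ∀ w ∈ W j, L k w ∈ W (j + k))
    (h11 : ∀ j : ℤ, ∀ w ∈ W j, L (-1) (L 1 w) - L 1 (L (-1) w) = (2 * (x₀ + j)) • w) :
    ∃ J : ℤ, ∀ j ≥ J, ∀ w ∈ W j, L (-1) w = 0 → w = 0 := by
  obtain ⟨m, hm⟩ := exists_int_gt (1 - x₀.re)
  have hre : ∀ j : ℤ, m ≤ j → 1 < (x₀ + j).re := fun j hj => by
    have : (m : ℝ) ≤ j := by exact_mod_cast hj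
    simp only [Complex.add_re, Complex.intCast_re]
    linarith
  set S : Set ℤ := {j | m ≤ j ∧ ∃ w ∈ W j, w ≠ 0 ∧ L (-1) w = 0} with hS
  have hfin : S.Finite := by
    by_contra hinf
    obtain ⟨t, htS, htc⟩ := Set.Infinite.exists_subset_card_eq hinf (N + 1)
    obtain ⟨J, hJ⟩ := t.exists_le
    have hi : ∀ s : t, ∃ i : ℕ, (s : ℤ) + i = J := fun s =>
      ⟨(J - s).toNat, by have := hJ s s.2; omega⟩
    choose i hi using hi
    have hw : ∀ s : t, ∃ w ∈ W s, w ≠ 0 ∧ L (-1) w = 0 := fun s => (htS s.2).2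
    choose w hwW hw0 hwL using hw
    have hsm : ∀ s : t, m ≤ (s : ℤ) := fun s => (htS s.2).1
    have hne : ∀ (s : t) (k : ℕ), (L 1 ^ k) (w s) ≠ 0 := by
      intro s k
      induction k with
      | zero => simpa using hw0 s
      | succ k ih =>
        intro h
        have h1 := lower_raise_pow L W x₀ hL h11 (hwW s) (hwL s) k
        rw [h, map_zero] at h1
        refine (smul_ne_zero (mul_ne_zero ?_ ?_) ih) h1.symm
        · exact_mod_cast k.succ_ne_zero
        · intro h2
          have h3 := congrArg Complex.re h2
          have h4 := hre s (hsm s)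
          simp at h3 h4
          linarith [(Nat.cast_nonneg k : (0 : ℝ) ≤ k)]
    have heig : ∀ s : t, Module.End.HasEigenvector (L 1 * L (-1))
        (i s * (2 * (x₀ + (s : ℤ)) + i s - 1)) ((L 1 ^ i s) (w s)) := by
      intro s
      refine Module.End.hasEigenvector_iff.2 ⟨Module.End.mem_eigenspace_iff.2 ?_, hne s _⟩
      rw [Module.End.mul_apply]
      cases h : i s with
      | zero => simp [hwL s]
      | succ k =>
        rw [lower_raise_pow L W x₀ hL h11 (hwW s) (hwL s) k, map_smul,
          ← Module.End.mul_apply (L 1) (L 1 ^ k), ← pow_succ']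
        congr 1
        push_cast
        ring
    have hinj : Function.Injective fun s : t =>
        (i s : ℂ) * (2 * (x₀ + (s : ℤ)) + i s - 1) := by
      intro s s' hss
      have e : ∀ s : t, (i s : ℂ) = J - (s : ℤ) := fun s => by
        rw [← hi s]; push_cast; ring
      simp only [e] at hss
      have h1 : ((s : ℤ) - (s' : ℤ) : ℂ) * ((x₀ + (s : ℤ)) + (x₀ + (s' : ℤ)) - 1) = 0 := by
        linear_combination -hss
      rcases mul_eq_zero.1 h1 with h2 | h2
      · exact Subtype.ext (by exact_mod_cast sub_eq_zero.1 h2)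
      · exfalso
        have h3 := congrArg Complex.re h2
        rw [Complex.sub_re, Complex.add_re, Complex.one_re, Complex.zero_re] at h3
        linarith [hre s (hsm s), hre s' (hsm s')]
    have hli := Module.End.eigenvectors_linearIndependent' _ _ hinj _ heig
    have hmem : ∀ s : t, (L 1 ^ i s) (w s) ∈ W J := fun s => by
      have := raise_pow_mem L W hL (hwW s) (i s)
      rwa [hi s] at this
    have hli' : LinearIndependent ℂ (fun s : t => (⟨_, hmem s⟩ : W J)) :=
      LinearIndependent.of_comp (W J).subtype hli
    have := hli'.fintype_card_le_finrank
    rw [Fintype.card_coe, htc] at this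
    exact absurd (this.trans (hN J)) (by omega)
  obtain ⟨b, hb⟩ := hfin.bddAbove
  refine ⟨max m (b + 1), fun j hj w hw h0 => ?_⟩
  by_contra hne
  have : j ≤ b := hb ⟨le_of_max_le_left hj, w, hw, hne, h0⟩
  have := le_of_max_le_right hj
  omega

/-- When all weight spaces from `J` on have the same dimension and `L (-1)` is injective on them,
they can be parametrised by `W J` compatibly with `L (-1)`. -/
theorem exists_trivialization [∀ j, FiniteDimensional ℂ (W j)] (J : ℤ)
    (hL : ∀ k j, ∀ w ∈ W j, L k w ∈ W (j + k))
    (hinj : ∀ j ≥ J, ∀ w ∈ W j, L (-1) w = 0 → w = 0)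
    (hdim : ∀ j ≥ J, Module.finrank ℂ (W j) = Module.finrank ℂ (W J)) :
    ∃ ψ : ℕ → (W J →ₗ[ℂ] V), (∀ k, Function.Injective (ψ k)) ∧
      (∀ k : ℕ, LinearMap.range (ψ k) = W (J + k)) ∧ ∀ k e, L (-1) (ψ (k + 1) e) = ψ k e := by
  have step : ∀ (k : ℕ) (φ : W J →ₗ[ℂ] V), Function.Injective φ ∧ LinearMap.range φ = W (J + k) →
      ∃ φ' : W J →ₗ[ℂ] V, (Function.Injective φ' ∧ LinearMap.range φ' = W (J + (k + 1 : ℕ))) ∧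
        ∀ e, L (-1) (φ' e) = φ e := by
    rintro k φ ⟨hφ, hr⟩
    have hmap : ∀ w ∈ W (J + (k + 1 : ℕ)), L (-1) w ∈ W (J + k) := fun w hw => by
      have := hL (-1) _ w hw
      rwa [show J + ((k + 1 : ℕ) : ℤ) + -1 = J + k by push_cast; ring] at this
    let D : W (J + (k + 1 : ℕ)) →ₗ[ℂ] W (J + k) := (L (-1)).restrict hmap
    have hDi : Function.Injective D := by
      rw [injective_iff_map_eq_zero]
      intro w hw
      exact Subtype.ext (hinj _ (by omega) w w.2 (congrArg Subtype.val hw))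
    have hDs : Function.Surjective D :=
      (LinearMap.injective_iff_surjective_of_finrank_eq_finrank
        ((hdim _ (by omega)).trans (hdim _ (by omega)).symm)).1 hDi
    obtain ⟨G, hG⟩ := LinearMap.exists_rightInverse_of_surjective D (LinearMap.range_eq_top.2 hDs)
    let φ' : W J →ₗ[ℂ] V := (W (J + (k + 1 : ℕ))).subtype ∘ₗ G ∘ₗ
      φ.codRestrict (W (J + k)) (fun e => hr ▸ LinearMap.mem_range_self φ e)
    have hφ' : ∀ e, L (-1) (φ' e) = φ e := fun e =>
      congrArg Subtype.val (LinearMap.congr_fun hG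
        (φ.codRestrict (W (J + k)) (fun e => hr ▸ LinearMap.mem_range_self φ e) e))
    have hi' : Function.Injective φ' := fun a b hab => hφ (by rw [← hφ', ← hφ', hab])
    refine ⟨φ', ⟨hi', ?_⟩, hφ'⟩
    refine Submodule.eq_of_le_of_finrank_eq ?_ ?_
    · rintro _ ⟨e, rfl⟩
      exact (G _).2
    · rw [LinearMap.finrank_range_of_inj hi', hdim (J + (k + 1 : ℕ)) (by omega)]
  choose! next hnext hlow using step
  let ψ : ℕ → (W J →ₗ[ℂ] V) := fun k => Nat.rec (W J).subtype next k
  have hψ : ∀ k, Function.Injective (ψ k) ∧ LinearMap.range (ψ k) = W (J + k) := by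
    intro k
    induction k with
    | zero => exact ⟨Subtype.val_injective, by simp [ψ]⟩
    | succ k ih => exact hnext k _ ih
  exact ⟨ψ, fun k => (hψ k).1, fun k => (hψ k).2, fun k => hlow k _ (hψ k)⟩

theorem central_term_eq_zero_of_constant_dim [∀ j, FiniteDimensional ℂ (W j)] (J : ℤ)
    (hL : ∀ k j, ∀ w ∈ W j, L k w ∈ W (j + k))
    (h11 : ∀ j : ℤ, ∀ w ∈ W j, L (-1) (L 1 w) - L 1 (L (-1) w) = (2 * (x₀ + j)) • w)
    (h12 : ∀ w, L (-1) (L 2 w) - L 2 (L (-1) w) = (3 : ℂ) • L 1 w)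
    (h1m2 : ∀ w, L 1 (L (-2) w) - L (-2) (L 1 w) = -((3 : ℂ) • L (-1) w))
    (h22 : ∀ j : ℤ, ∀ w ∈ W j, L 2 (L (-2) w) - L (-2) (L 2 w) = (-4 * (x₀ + j) + z) • w)
    (hinj : ∀ j ≥ J, ∀ w ∈ W j, L (-1) w = 0 → w = 0)
    (hdim : ∀ j ≥ J, Module.finrank ℂ (W j) = Module.finrank ℂ (W J)) (hJ : W J ≠ ⊥) :
    z = 0 := by
  have : Nontrivial (W J) := Submodule.nontrivial_iff_ne_bot.2 hJ
  obtain ⟨ψ, hi, hr, hψ⟩ := exists_trivialization L W J hL hinj hdim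
  have hmem : ∀ (k : ℕ) e, ψ k e ∈ W (J + k) := fun k e => hr k ▸ LinearMap.mem_range_self _ e
  have lift : ∀ (s : ℤ) (k l : ℕ), (k : ℤ) + s = l →
      ∃ Q : Module.End ℂ (W J), ∀ e, L s (ψ k e) = ψ l (Q e) := by
    intro s k l hkl
    have hm : ∀ e, L s (ψ k e) ∈ LinearMap.range (ψ l) := fun e => by
      have := hL s _ _ (hmem k e)
      rwa [add_assoc, hkl, ← hr l] at this
    refine ⟨(LinearEquiv.ofInjective (ψ l) (hi l)).symm.toLinearMap ∘ₗ
      (L s ∘ₗ ψ k).codRestrict _ hm, fun e => ?_⟩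
    have := congrArg Subtype.val ((LinearEquiv.ofInjective (ψ l) (hi l)).apply_symm_apply
      ((L s ∘ₗ ψ k).codRestrict _ hm e))
    exact this.symm
  choose Q hQ using fun k : ℕ => lift 1 k (k + 1) (by push_cast; ring)
  choose B hB using fun k : ℕ => lift 2 k (k + 2) (by push_cast; ring)
  choose X hX using fun k : ℕ => lift (-2) (k + 2) k (by push_cast; ring)
  have rQ : ∀ k, Q (k + 1) = Q k + (2 * (x₀ + J + k + 1)) • 1 := by
    intro k
    ext1 e
    apply hi (k + 1)
    have := h11 _ _ (hmem (k + 1) e)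
    rw [hQ, hψ, hψ, hQ, sub_eq_iff_eq_add] at this
    rw [this, LinearMap.add_apply, map_add, LinearMap.smul_apply, map_smul, add_comm]
    congr 2
    push_cast
    ring
  have rB : ∀ k, B (k + 1) = B k + (3 : ℂ) • Q (k + 1) := by
    intro k
    ext1 e
    apply hi (k + 2)
    have := h12 (ψ (k + 1) e)
    rw [hB, hψ, hψ, hB, hQ, sub_eq_iff_eq_add] at this
    rw [this, LinearMap.add_apply, map_add, LinearMap.smul_apply, map_smul, add_comm]
  have rX : ∀ k, Q k * X k - X (k + 1) * Q (k + 2) = -((3 : ℂ) • 1) := by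
    intro k
    ext1 e
    apply hi (k + 1)
    have := h1m2 (ψ (k + 2) e)
    rw [hX, hQ, hQ, hX (k + 1), hψ] at this
    simpa only [LinearMap.sub_apply, map_sub, LinearMap.neg_apply, map_neg, LinearMap.smul_apply,
      map_smul, Module.End.mul_apply, Module.End.one_apply] using this
  obtain ⟨u, hu⟩ : ∃ u : ℕ → ℂ, ∀ k, u k = x₀ + J + k + 1 := ⟨_, fun _ => rfl⟩
  have rBX : ∀ k, B k * X k - X (k + 2) * B (k + 2) = (-4 * (u k + 1) + z) • 1 := by
    intro k
    ext1 e
    apply hi (k + 2)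
    have := h22 _ _ (hmem (k + 2) e)
    rw [hX, hB, hB, hX (k + 2)] at this
    rw [LinearMap.sub_apply, map_sub, LinearMap.smul_apply, map_smul]
    refine this.trans ?_
    congr 1
    rw [hu]
    push_cast
    ring
  have hu1 : ∀ k, u (k + 1) = u k + 1 := fun k => by rw [hu, hu]; push_cast; ring
  obtain ⟨C, hC⟩ : ∃ C : Module.End ℂ (W J), C = (u 0 * (u 0 - 1)) • 1 - Q 0 := ⟨_, rfl⟩
  have fQ : ∀ k, Q k = (u k * (u k - 1)) • 1 - C := by
    intro k
    induction k with
    | zero => rw [hC]; abel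
    | succ k ih =>
      rw [rQ, ih, hu1, hu]
      match_scalars <;> ring
  obtain ⟨B₀, hB₀⟩ : ∃ B₀ : Module.End ℂ (W J),
    B₀ = B 0 - ((u 0 * (u 0 ^ 2 - 1)) • 1 - (3 * u 0) • C) := ⟨_, rfl⟩
  have fB : ∀ k, B k = (u k * (u k ^ 2 - 1)) • 1 - (3 * u k) • C + B₀ := by
    intro k
    induction k with
    | zero => rw [hB₀]; abel
    | succ k ih =>
      rw [rB, ih, fQ, hu1]
      match_scalars <;> ring
  have hu2 : ∀ k, u (k + 2) = u k + 2 := fun k => by rw [hu, hu]; push_cast; ring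
  refine central_term_eq_zero_of_finiteDimensional C B₀ z u hu1 X (fun k => ?_) (fun k => ?_)
  · have := rX k
    rw [fQ, fQ, hu2] at this
    rw [← this]
    congr 4
    ring
  · have := rBX k
    rwa [fB, fB, hu2] at this

/-- For a graded Virasoro module with bounded weight multiplicities, either the central charge
vanishes or the weights are bounded above. -/
theorem central_term_eq_zero_or_bounded [∀ j, FiniteDimensional ℂ (W j)] (N : ℕ)
    (hN : ∀ j, Module.finrank ℂ (W j) ≤ N)
    (hL : ∀ k j, ∀ w ∈ W j, L k w ∈ W (j + k))
    (h11 : ∀ j : ℤ, ∀ w ∈ W j, L (-1) (L 1 w) - L 1 (L (-1) w) = (2 * (x₀ + j)) • w)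
    (h12 : ∀ w, L (-1) (L 2 w) - L 2 (L (-1) w) = (3 : ℂ) • L 1 w)
    (h1m2 : ∀ w, L 1 (L (-2) w) - L (-2) (L 1 w) = -((3 : ℂ) • L (-1) w))
    (h22 : ∀ j : ℤ, ∀ w ∈ W j, L 2 (L (-2) w) - L (-2) (L 2 w) = (-4 * (x₀ + j) + z) • w) :
    z = 0 ∨ ∃ J : ℤ, ∀ j ≥ J, W j = ⊥ := by
  obtain ⟨J, hJ⟩ := exists_lower_injective L W x₀ N hN hL h11
  have anti : ∀ j ≥ J, Module.finrank ℂ (W (j + 1)) ≤ Module.finrank ℂ (W j) := by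
    intro j hj
    have hmap : ∀ w ∈ W (j + 1), L (-1) w ∈ W j := fun w hw => by
      simpa using hL (-1) _ w hw
    refine LinearMap.finrank_le_finrank_of_injective (f := (L (-1)).restrict hmap) ?_
    rw [injective_iff_map_eq_zero]
    intro w hw
    exact Subtype.ext (hJ _ (by omega) w w.2 (congrArg Subtype.val hw))
  obtain ⟨j₀, hj₀, hmin⟩ : ∃ j₀ ≥ J, ∀ j ≥ J,
      Module.finrank ℂ (W j₀) ≤ Module.finrank ℂ (W j) := by
    obtain ⟨j₀, h1, h2⟩ := exists_minimalFor_of_wellFoundedLT (fun j => J ≤ j)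
      (fun j => Module.finrank ℂ (W j)) ⟨J, le_rfl⟩
    exact ⟨j₀, h1, fun j hj => (le_total _ _).elim id (h2 hj)⟩
  have hdim : ∀ j ≥ j₀, Module.finrank ℂ (W j) = Module.finrank ℂ (W j₀) := by
    intro j hj
    refine le_antisymm ?_ (hmin j (hj₀.le.trans hj))
    induction j, hj using Int.leInduction with
    | base => exact le_rfl
    | succ j hj ih => exact (anti j (hj₀.le.trans hj)).trans ih
  by_cases h0 : W j₀ = ⊥
  · refine Or.inr ⟨j₀, fun j hj => Submodule.finrank_eq_zero.1 ?_⟩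
    rw [hdim j hj, h0, finrank_bot]
  · exact Or.inl (central_term_eq_zero_of_constant_dim L W x₀ z j₀ hL h11 h12 h1m2 h22
      (fun j hj => hJ j (hj₀.le.trans hj)) hdim h0)

end WeightSpaces

section Virasoro

variable {V : Type*} [AddCommGroup V] [Module ℂ V]

/-- Virasoro operators shift the weight. -/
theorem apply_mem_eigenspace (T : ℤ → Module.End ℂ V) (a ζ lam : ℂ)
    (hT : ∀ (j k : ℤ) (v : V), T j (T k v) - T k (T j v) = (a * (k - j)) • T (j + k) v +
      (if j = -k then ((j * a) ^ 3 - j * a) / 12 * ζ else 0) • v) :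
    ∀ k j : ℤ, ∀ w ∈ Module.End.eigenspace (T 0) (lam + j * a),
      T k w ∈ Module.End.eigenspace (T 0) (lam + (j + k : ℤ) * a) := by
  intro k j w hw
  rw [Module.End.mem_eigenspace_iff] at hw ⊢
  have := hT 0 k w
  rw [hw, map_smul, zero_add, sub_eq_iff_eq_add] at this
  rw [this]
  have h0 : (if (0 : ℤ) = -k then (((0 : ℤ) * a) ^ 3 - (0 : ℤ) * a) / 12 * ζ else 0) = 0 := by
    simp
  rw [h0, zero_smul, add_zero, ← add_smul]
  congr 1
  push_cast
  ring

/-- For operators `T k` satisfying (rescaled) Virasoro relations with central charge `ζ` and bounded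
weight multiplicities, either `ζ = 0` or each weight string is bounded above. -/
theorem central_charge_eq_zero_or_string_bounded (T : ℤ → Module.End ℂ V) (a ζ lam : ℂ) (ha : a ≠ 0)
    (hT : ∀ (j k : ℤ) (v : V), T j (T k v) - T k (T j v) = (a * (k - j)) • T (j + k) v +
      (if j = -k then ((j * a) ^ 3 - j * a) / 12 * ζ else 0) • v)
    (N : ℕ) (hcusp : ∀ lam : ℂ, Module.Finite ℂ (Module.End.eigenspace (T 0) lam) ∧
      Module.finrank ℂ (Module.End.eigenspace (T 0) lam) ≤ N) :
    ζ = 0 ∨ ∃ J : ℤ, ∀ j ≥ J, Module.End.eigenspace (T 0) (lam + j * a) = ⊥ := by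
  have hfin : ∀ j : ℤ, FiniteDimensional ℂ (Module.End.eigenspace (T 0) (lam + j * a)) :=
    fun j => (hcusp _).1
  have hTm := apply_mem_eigenspace T a ζ lam hT
  have hL : ∀ (j k : ℤ) (v : V), (a⁻¹ • T j) ((a⁻¹ • T k) v) - (a⁻¹ • T k) ((a⁻¹ • T j) v) =
      ((k - j : ℂ)) • (a⁻¹ • T (j + k)) v +
        (a⁻¹ ^ 2 * (if j = -k then ((j * a) ^ 3 - j * a) / 12 * ζ else 0)) • v := by
    intro j k v
    simp only [LinearMap.smul_apply, map_smul]
    rw [mul_smul, ← sub_eq_iff_eq_add'.2 (hT j k v)]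
    match_scalars <;> field_simp
    ring
  have hL0 : ∀ j : ℤ, ∀ w ∈ Module.End.eigenspace (T 0) (lam + j * a),
      (a⁻¹ • T 0) w = (lam / a + j) • w := by
    intro j w hw
    rw [LinearMap.smul_apply, Module.End.mem_eigenspace_iff.1 hw, smul_smul]
    congr 1
    field_simp
  have h11 : ∀ j : ℤ, ∀ w ∈ Module.End.eigenspace (T 0) (lam + j * a),
      (a⁻¹ • T (-1)) ((a⁻¹ • T 1) w) - (a⁻¹ • T 1) ((a⁻¹ • T (-1)) w) =
        (2 * (lam / a - (a - a⁻¹) * ζ / 24 + j)) • w := by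
    intro j w hw
    refine (hL (-1) 1 w).trans ?_
    rw [if_pos rfl, neg_add_cancel, hL0 j w hw, smul_smul, ← add_smul]
    congr 1
    push_cast
    field_simp
    ring
  have h12 : ∀ w, (a⁻¹ • T (-1)) ((a⁻¹ • T 2) w) - (a⁻¹ • T 2) ((a⁻¹ • T (-1)) w) =
      (3 : ℂ) • (a⁻¹ • T 1) w := by
    intro w
    refine (hL (-1) 2 w).trans ?_
    rw [if_neg (by norm_num), mul_zero, zero_smul, add_zero]
    norm_num
  have h1m2 : ∀ w, (a⁻¹ • T 1) ((a⁻¹ • T (-2)) w) - (a⁻¹ • T (-2)) ((a⁻¹ • T 1) w) =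
      -((3 : ℂ) • (a⁻¹ • T (-1)) w) := by
    intro w
    refine (hL 1 (-2) w).trans ?_
    rw [if_neg (by norm_num), mul_zero, zero_smul, add_zero, ← neg_smul]
    norm_num
  have h22 : ∀ j : ℤ, ∀ w ∈ Module.End.eigenspace (T 0) (lam + j * a),
      (a⁻¹ • T 2) ((a⁻¹ • T (-2)) w) - (a⁻¹ • T (-2)) ((a⁻¹ • T 2) w) =
        (-4 * (lam / a - (a - a⁻¹) * ζ / 24 + j) + a * ζ / 2) • w := by
    intro j w hw
    refine (hL 2 (-2) w).trans ?_
    rw [if_pos (by norm_num), add_neg_cancel, hL0 j w hw, smul_smul, ← add_smul]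
    congr 1
    push_cast
    field_simp
    ring
  refine (central_term_eq_zero_or_bounded (fun k => a⁻¹ • T k)
    (fun j => Module.End.eigenspace (T 0) (lam + j * a)) (lam / a - (a - a⁻¹) * ζ / 24) (a * ζ / 2)
    N (fun j => (hcusp _).2)
    (fun k j w hw => Submodule.smul_mem _ _ (hTm k j w hw)) h11 h12 h1m2 h22).imp_left fun h => ?_
  simpa [ha] using h

/-- The central charge of a Virasoro module with bounded weight multiplicities vanishes. -/
theorem central_charge_eq_zero (T : ℤ → Module.End ℂ V) (a ζ lam : ℂ) (ha : a ≠ 0)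
    (hT : ∀ (j k : ℤ) (v : V), T j (T k v) - T k (T j v) = (a * (k - j)) • T (j + k) v +
      (if j = -k then ((j * a) ^ 3 - j * a) / 12 * ζ else 0) • v)
    (N : ℕ) (hcusp : ∀ lam : ℂ, Module.Finite ℂ (Module.End.eigenspace (T 0) lam) ∧
      Module.finrank ℂ (Module.End.eigenspace (T 0) lam) ≤ N)
    (hlam : Module.End.eigenspace (T 0) lam ≠ ⊥) : ζ = 0 := by
  rcases central_charge_eq_zero_or_string_bounded T a ζ lam ha hT N hcusp with h | ⟨J₁, hJ₁⟩
  · exact h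
  have hT' : ∀ (j k : ℤ) (v : V), T (-j) (T (-k) v) - T (-k) (T (-j) v) =
      (-a * (k - j)) • T (-(j + k)) v +
        (if j = -k then ((j * -a) ^ 3 - j * -a) / 12 * ζ else 0) • v := by
    intro j k v
    rw [hT, neg_add]
    simp only [neg_inj]
    push_cast
    congr 2 <;> ring_nf
  rcases central_charge_eq_zero_or_string_bounded (fun k => T (-k)) (-a) ζ lam (neg_ne_zero.2 ha)
    hT' N hcusp with h | ⟨J₂, hJ₂⟩
  · exact h
  replace hJ₂ : ∀ j : ℤ, j ≤ -J₂ → Module.End.eigenspace (T 0) (lam + j * a) = ⊥ := by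
    intro j hj
    have := hJ₂ (-j) (by omega)
    rw [neg_zero] at this
    rw [← this]
    congr 1
    push_cast
    ring
  have hTm := apply_mem_eigenspace T a ζ lam hT
  obtain ⟨w, hw, hw0⟩ := Submodule.exists_mem_ne_zero_of_ne_bot hlam
  have hw : w ∈ Module.End.eigenspace (T 0) (lam + (0 : ℤ) * a) := by simpa using hw
  obtain ⟨K, hK⟩ : ∃ K : ℕ, ∀ k : ℕ, K ≤ k → J₁ ≤ k ∧ -(k : ℤ) ≤ -J₂ ∧ 1 ≤ k :=
    ⟨J₁.toNat + J₂.toNat + 1, fun k hk => by omega⟩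
  have rel : ∀ k : ℕ, K ≤ k → -(2 * lam) + (k ^ 2 * a ^ 2 - 1) / 12 * ζ = 0 := by
    intro k hk
    obtain ⟨h1, h2, h3⟩ := hK k hk
    have e1 : T k w = 0 := by
      have := hTm k 0 w hw
      rwa [zero_add, hJ₁ _ h1, Submodule.mem_bot] at this
    have e2 : T (-k) w = 0 := by
      have := hTm (-k) 0 w hw
      rwa [zero_add, hJ₂ _ h2, Submodule.mem_bot] at this
    have := hT k (-k) w
    rw [e1, e2, map_zero, map_zero, sub_zero, if_pos (by simp), add_neg_cancel,
      Module.End.mem_eigenspace_iff.1 hw, smul_smul, ← add_smul, eq_comm, smul_eq_zero] at this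
    have h4 := this.resolve_right hw0
    have hka : (k : ℂ) * a ≠ 0 := mul_ne_zero (by exact_mod_cast (by omega : k ≠ 0)) ha
    push_cast at h4
    refine (mul_eq_zero.1 (?_ : ((k : ℂ) * a) * _ = 0)).resolve_left hka
    linear_combination h4
  have r1 := rel K le_rfl
  have r2 := rel (K + 1) (by omega)
  push_cast at r2
  have h5 : a ^ 2 * (2 * (K : ℂ) + 1) * ζ = 0 := by linear_combination 12 * (r2 - r1)
  refine (mul_eq_zero.1 h5).resolve_left (mul_ne_zero (pow_ne_zero 2 ha) ?_)
  exact_mod_cast (2 * K).succ_ne_zero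

/-- Schur's lemma for the centre: an operator commuting with an irreducible action and preserving
a nonzero finite-dimensional subspace is a scalar. -/
theorem exists_scalar_of_irreducible {𝔤 : Type*} (ρ : 𝔤 → Module.End ℂ V) (c : Module.End ℂ V)
    (hc : ∀ x v, c (ρ x v) = ρ x (c v))
    (hirr : ∀ U : Submodule ℂ V, (∀ x, ∀ w ∈ U, ρ x w ∈ U) → U = ⊥ ∨ U = ⊤)
    (W : Submodule ℂ V) [FiniteDimensional ℂ W] (hW : W ≠ ⊥) (hcW : ∀ w ∈ W, c w ∈ W) :
    ∃ ζ : ℂ, ∀ v, c v = ζ • v := by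
  have := Submodule.nontrivial_iff_ne_bot.2 hW
  obtain ⟨ζ, hζ⟩ := Module.End.exists_eigenvalue (c.restrict hcW)
  obtain ⟨w, hw⟩ := hζ.exists_hasEigenvector
  have hcw : (w : V) ∈ Module.End.eigenspace c ζ :=
    Module.End.mem_eigenspace_iff.2 (congrArg Subtype.val hw.apply_eq_smul)
  have hinv : ∀ x, ∀ v ∈ Module.End.eigenspace c ζ, ρ x v ∈ Module.End.eigenspace c ζ := by
    intro x v hv
    rw [Module.End.mem_eigenspace_iff] at hv ⊢
    rw [hc, hv, map_smul]
  rcases hirr (Module.End.eigenspace c ζ) hinv with h | h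
  · rw [h, Submodule.mem_bot] at hcw
    exact absurd (Subtype.ext hcw) hw.2
  · exact ⟨ζ, fun v => Module.End.mem_eigenspace_iff.1 (h ▸ Submodule.mem_top)⟩

end Virasoro

theorem mdot_zsmul {n : ℕ} (μ : Fin n → ℂ) (k : ℤ) (α : Zn n) :
    mdot μ (k • α) = k * mdot μ α := by
  simp only [mdot, Finset.mul_sum, Pi.smul_apply, smul_eq_mul, Int.cast_mul]
  exact Finset.sum_congr rfl fun i _ => by ring

/-- On a nonzero irreducible cuspidal module `V` over the solenoidal Virasoro algebra
`Vir(n)_μ` (i.e. `V` is the direct sum of the eigenspaces of `e_0`, of dimensions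
uniformly bounded by some `N`), the central element `c_μ` acts trivially. -/
theorem stmt15 (n : ℕ) (hn : 1 ≤ n) (μ : Fin n → ℂ) (hμ : Generic μ)
    (B : Virn n →ₗ[ℂ] Virn n →ₗ[ℂ] Virn n)
    (hBe : ∀ α β : Zn n, B (ev α) (ev β) =
      (Finsupp.single (α + β) (mdot μ (β - α)),
        if α = -β then ((mdot μ α) ^ 3 - mdot μ α) / 12 else 0))
    (hBc : ∀ x : Virn n, B x cv = 0)
    (hcB : ∀ x : Virn n, B cv x = 0)
    (V : Type) [AddCommGroup V] [Module ℂ V] [Nontrivial V]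
    (ρ : Virn n →ₗ[ℂ] V →ₗ[ℂ] V)
    (hLie : ∀ (x y : Virn n) (w : V), ρ (B x y) w = ρ x (ρ y w) - ρ y (ρ x w))
    (hirr : ∀ U : Submodule ℂ V, (∀ (x : Virn n), ∀ w ∈ U, ρ x w ∈ U) → U = ⊥ ∨ U = ⊤)
    (hwt : (⨆ lam : ℂ, Module.End.eigenspace (ρ (ev 0)) lam) = ⊤)
    (N : ℕ)
    (hcusp : ∀ lam : ℂ, Module.Finite ℂ (Module.End.eigenspace (ρ (ev 0)) lam) ∧
      Module.finrank ℂ (Module.End.eigenspace (ρ (ev 0)) lam) ≤ N) :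
    ∀ v : V, ρ cv v = 0 := by
  have hbr : ∀ (α β : Zn n) (v : V), ρ (ev α) (ρ (ev β) v) - ρ (ev β) (ρ (ev α) v) =
      mdot μ (β - α) • ρ (ev (α + β)) v +
        (if α = -β then ((mdot μ α) ^ 3 - mdot μ α) / 12 else 0) • ρ cv v := by
    intro α β v
    have hdec : ∀ (γ : Zn n) (s t : ℂ),
        ((Finsupp.single γ s, t) : Virn n) = s • ev γ + t • cv := fun γ s t => by
      simp [ev, cv]
    rw [← hLie, hBe, hdec, map_add, map_smul, map_smul]
    rfl
  have hcomm : ∀ (x : Virn n) (v : V), ρ cv (ρ x v) = ρ x (ρ cv v) := fun x v => by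
    have := hLie cv x v
    rw [hcB, map_zero, LinearMap.zero_apply] at this
    exact (sub_eq_zero.1 this.symm)
  obtain ⟨lam, hlam⟩ : ∃ lam, Module.End.eigenspace (ρ (ev 0)) lam ≠ ⊥ := by
    by_contra! h
    simp only [h, iSup_bot] at hwt
    exact bot_ne_top hwt
  have := (hcusp lam).1
  obtain ⟨ζ, hζ⟩ := exists_scalar_of_irreducible (fun x => ρ x) (ρ cv) hcomm hirr
    (Module.End.eigenspace (ρ (ev 0)) lam) hlam (fun w hw => by
      rw [Module.End.mem_eigenspace_iff] at hw ⊢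
      rw [← hcomm, hw, map_smul])
  obtain ⟨α, hα⟩ : ∃ α : Zn n, α ≠ 0 := ⟨Pi.single ⟨0, hn⟩ 1, by simp⟩
  have ha : mdot μ α ≠ 0 := hμ α hα
  have h0 : ρ (ev ((0 : ℤ) • α)) = ρ (ev 0) := by rw [zero_smul]
  have hζ0 : ζ = 0 := by
    refine central_charge_eq_zero (fun k => ρ (ev (k • α))) (mdot μ α) ζ lam ha (fun j k v => ?_) N
      (by rw [h0]; exact hcusp) (by simpa using hlam)
    have hiff : j • α = -(k • α) ↔ j = -k := by
      rw [← neg_smul]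
      exact (smul_left_injective ℤ hα).eq_iff
    refine (hbr (j • α) (k • α) v).trans ?_
    rw [hζ, smul_smul, ← sub_smul, ← add_smul, mdot_zsmul, mdot_zsmul]
    simp only [hiff, ite_mul, zero_mul]
    congr 2
    push_cast
    ring
  intro v
  rw [hζ, hζ0, zero_smul]
end

section
/- Assume n ≥ 2. Let λ, c ∈ ℂ with (λ, c) ≠ (0, 0), and let V be an irreducible Vir(n)_μ-module containing a nonzero vector v with e_0·v = λv, c_μ·v = c·v, and e_α·v = 0 for all α ∈ ℤⁿ with 0 <_lex α (an irreducible highest weight module with respect to the lexicographic triangular decomposition). Then V has an infinite-dimensional weight space: there exists κ ∈ ℂ such that the eigenspace V_κ = {w ∈ V : e_0·w = κw} is infinite-dimensional. -/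
/-- A family of vectors on which some family of linear maps acts triangularly with nonzero
diagonal is linearly independent. -/
theorem linearIndependent_of_triangular {K V W : Type*} [Field K] [AddCommGroup V] [Module K V]
    [AddCommGroup W] [Module K W] (x : ℕ → V) (T : ℕ → V →ₗ[K] W)
    (hzero : ∀ j k, j < k → T j (x k) = 0) (hdiag : ∀ j, T j (x j) ≠ 0) :
    LinearIndependent K x := by
  rw [linearIndependent_iff']
  intro s g hg i
  induction i using Nat.strong_induction_on with
  | _ i ih =>
    intro hi
    have h := congrArg (T i) hg
    rw [map_sum, map_zero, Finset.sum_eq_single i] at h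
    · rw [map_smul] at h
      exact (smul_eq_zero.mp h).resolve_right (hdiag i)
    · intro k hk hki
      rcases lt_or_gt_of_ne hki with hlt | hgt
      · rw [ih k hlt hk, zero_smul, map_zero]
      · rw [map_smul, hzero i k hgt, smul_zero]
    · exact fun h' => absurd hi h'

/-- The scalar by which `[e_α, e_{-α}]` acts on a vector of weight `lam` and central charge `c`,
as a function of `t = μ·α`. -/
noncomputable def bracketScalar (lam c t : ℂ) : ℂ := (t ^ 3 - t) / 12 * c - 2 * t * lam

theorem eventually_bracketScalar_ne_zero {lam c : ℂ} (hlc : (lam, c) ≠ (0, 0)) {m : ℂ}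
    (hm : m ≠ 0) (h : ℂ) :
    ∀ᶠ j : ℕ in Filter.atTop, bracketScalar lam c (j * m - h) ≠ 0 := by
  let p : Polynomial ℂ := Polynomial.C (c / 12) * (Polynomial.X ^ 3 - Polynomial.X) -
    Polynomial.C (2 * lam) * Polynomial.X
  have hp : p ≠ 0 := by
    intro hp
    have h3 := congrArg (fun q => Polynomial.eval 1 q) hp
    have h2 := congrArg (fun q => Polynomial.eval 2 q) hp
    simp [p] at h3 h2
    subst h3
    norm_num at h2
    exact hlc (by rw [h2])
  have heval : ∀ t, p.eval t = bracketScalar lam c t := by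
    intro t
    simp [p, bracketScalar]
    ring
  rw [← Nat.cofinite_eq_atTop]
  have hinj : Function.Injective fun j : ℕ => (j : ℂ) * m - h := by
    intro a b hab
    simpa [hm] using hab
  refine ((Polynomial.finite_setOfPred_isRoot hp).preimage hinj.injOn).subset ?_
  intro j hj
  simpa [Polynomial.IsRoot, heval] using hj

/-- A highest weight vector for the rank two solenoidal Virasoro algebra, with respect to the
lexicographic order and not of weight `(0, 0)`, generates an infinite-dimensional weight space. -/
theorem not_finite_eigenspace_of_rank_two {V : Type*} [AddCommGroup V] [Module ℂ V]
    (h m : ℂ) (hm : m ≠ 0) (E : ℤ → ℤ → V →ₗ[ℂ] V) (Z : V →ₗ[ℂ] V)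
    (hE : ∀ a b a' b' w, ¬ (a + a' = 0 ∧ b + b' = 0) →
      E a b (E a' b' w) = E a' b' (E a b w) +
        (h * (a' - a) + m * (b' - b)) • E (a + a') (b + b') w)
    (hEZ : ∀ a b w, E a b (E (-a) (-b) w) = E (-a) (-b) (E a b w) +
        (-2 * (h * a + m * b)) • E 0 0 w +
        (((h * a + m * b) ^ 3 - (h * a + m * b)) / 12) • Z w)
    (hZ : ∀ a b w, Z (E a b w) = E a b (Z w))
    {lam c : ℂ} (hlc : (lam, c) ≠ (0, 0)) {v : V} (hv : v ≠ 0)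
    (hwt : E 0 0 v = lam • v) (hc : Z v = c • v)
    (h1 : ∀ b, E 1 b v = 0) (h0 : ∀ b, 0 < b → E 0 b v = 0) :
    ¬ Module.Finite ℂ (Module.End.eigenspace (E 0 0) (lam - h)) := by
  obtain ⟨N, hN⟩ := Filter.eventually_atTop.mp
    ((eventually_bracketScalar_ne_zero hlc hm 0).and
      ((eventually_bracketScalar_ne_zero hlc hm h).and (Filter.eventually_ge_atTop 1)))
  have hlow : ∀ j : ℕ, N ≤ j → E 0 (-j) v ≠ 0 := by
    intro j hj hz
    obtain ⟨hA, -, hj1⟩ := hN j hj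
    have hcomm := hEZ 0 j v
    rw [neg_zero, hz, h0 j (by exact_mod_cast hj1), hwt, hc, map_zero, map_zero, zero_add,
      smul_smul, smul_smul, ← add_smul] at hcomm
    refine hA (Eq.trans ?_ ((smul_eq_zero.mp hcomm.symm).resolve_right hv))
    simp only [bracketScalar]
    push_cast
    ring
  have hraise : ∀ i b, E 1 i (E 0 b v) = 0 := by
    intro i b
    rw [hE _ _ _ _ _ (by simp), add_zero, h1, h1, map_zero, smul_zero, add_zero]
  have hweight : ∀ a b w, (E 0 0) (E a b w) = E a b (E 0 0 w) + (h * a + m * b) • E a b w := by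
    intro a b w
    by_cases hab : a = 0 ∧ b = 0
    · obtain ⟨rfl, rfl⟩ := hab
      simp
    · rw [hE _ _ _ _ _ (by simpa using hab)]
      simp
  let w : ℤ → V := fun k => E (-1) k (E 0 (-k) v)
  have hw : ∀ k, E 0 0 (w k) = (lam - h) • w k := by
    intro k
    simp only [w]
    rw [hweight, hweight, hwt, map_add, map_smul, map_smul, map_smul]
    push_cast
    module
  have hoff : ∀ j k : ℤ, 0 < j → j < k → E 1 (-j) (w k) =
      (((k + j) * m - 2 * h) * (m * (j - 2 * k))) • E 0 (-j) v := by
    intro j k hj hjk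
    simp only [w]
    rw [hE _ _ _ _ _ (by omega), hraise, map_zero, zero_add, show (1 : ℤ) + -1 = 0 by rfl,
      hE _ _ _ _ _ (by omega), h0 _ (by omega), map_zero, zero_add, add_zero,
      show -j + k + -k = -j by ring, smul_smul]
    congr 1
    push_cast
    ring
  have hdiag : ∀ j : ℤ, E 1 (-j) (w j) =
      ((2 * j * m - 2 * h) * (lam - j * m) +
        ((h - j * m) ^ 3 - (h - j * m)) / 12 * c) • E 0 (-j) v := by
    intro j
    have hcomm := hEZ 1 (-j) (E 0 (-j) v)
    rw [neg_neg, hraise, map_zero, zero_add, hweight, hwt, hZ, hc, map_smul, map_smul] at hcomm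
    simp only [w]
    rw [hcomm]
    push_cast
    module
  let x : ℕ → V := fun k => w ((N + k : ℕ) + 3) - (3 : ℂ) • w ((N + k : ℕ) + 2) +
    (3 : ℂ) • w ((N + k : ℕ) + 1) - w (N + k : ℕ)
  have hx : ∀ k, x k ∈ Module.End.eigenspace (E 0 0) (lam - h) := by
    intro k
    rw [Module.End.mem_eigenspace_iff]
    simp only [x, map_sub, map_add, map_smul, hw]
    module
  have hpos : ∀ j, (0 : ℤ) < (N + j : ℕ) := fun j => by
    exact_mod_cast (hN (N + j) (Nat.le_add_right _ _)).2.2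
  have hind : LinearIndependent ℂ x := by
    refine linearIndependent_of_triangular x (fun j => E 1 (-(N + j : ℕ))) ?_ ?_
    · intro j k hjk
      have hj := hpos j
      have hlt : ((N + j : ℕ) : ℤ) < (N + k : ℕ) := by omega
      simp only [x, map_sub, map_add, map_smul]
      rw [hoff _ _ hj hlt, hoff _ _ hj (by omega), hoff _ _ hj (by omega),
        hoff _ _ hj (by omega)]
      push_cast
      module
    · intro j hz
      have hj := hpos j
      simp only [x, map_sub, map_add, map_smul] at hz
      rw [hdiag, hoff _ _ hj (by omega), hoff _ _ hj (by omega),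
        hoff _ _ hj (by omega)] at hz
      refine smul_ne_zero (hN (N + j) (Nat.le_add_right _ _)).2.1
        (hlow (N + j) (Nat.le_add_right _ _)) ?_
      rw [← hz]
      simp only [bracketScalar]
      push_cast
      module
  intro hfin
  have hind' : LinearIndependent ℂ
      (fun k => (⟨x k, hx k⟩ : Module.End.eigenspace (E 0 0) (lam - h))) :=
    LinearIndependent.of_comp (Submodule.subtype _) hind
  have := hind'.finite
  exact not_finite ℕ

/-- For `n ≥ 2` and `(λ, c) ≠ (0, 0)`, an irreducible highest weight module over the
solenoidal Virasoro algebra `Vir(n)_μ` (with respect to the lexicographic triangular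
decomposition) has an infinite-dimensional weight space: some eigenspace of `e_0`
is infinite dimensional. -/
theorem stmt19 (n : ℕ) (hn : 2 ≤ n) (μ : Fin n → ℂ) (hμ : Generic μ)
    (B : Virn n →ₗ[ℂ] Virn n →ₗ[ℂ] Virn n)
    (hBe : ∀ α β : Zn n, B (ev α) (ev β) =
      (Finsupp.single (α + β) (mdot μ (β - α)),
        if α = -β then ((mdot μ α) ^ 3 - mdot μ α) / 12 else 0))
    (hBc : ∀ x : Virn n, B x cv = 0)
    (hcB : ∀ x : Virn n, B cv x = 0)
    (V : Type) [AddCommGroup V] [Module ℂ V]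
    (ρ : Virn n →ₗ[ℂ] V →ₗ[ℂ] V)
    (hLie : ∀ (x y : Virn n) (w : V), ρ (B x y) w = ρ x (ρ y w) - ρ y (ρ x w))
    (hirr : ∀ U : Submodule ℂ V, (∀ (x : Virn n), ∀ w ∈ U, ρ x w ∈ U) → U = ⊥ ∨ U = ⊤)
    (lam c : ℂ) (hlc : (lam, c) ≠ (0, 0))
    (v : V) (hv : v ≠ 0)
    (hwt : ρ (ev 0) v = lam • v) (hc : ρ cv v = c • v)
    (hhw : ∀ α : Zn n, toLex (0 : Zn n) < toLex α → ρ (ev α) v = 0) :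
    ∃ κ : ℂ, ¬ Module.Finite ℂ (Module.End.eigenspace (ρ (ev 0)) κ) := by
  let i₀ : Fin n := ⟨0, by omega⟩
  let i₁ : Fin n := ⟨1, by omega⟩
  have hne : i₀ ≠ i₁ := by simp [i₀, i₁]
  let f : ℤ → ℤ → Zn n := fun a b => Pi.single i₀ a + Pi.single i₁ b
  have hf0 : ∀ a b, f a b i₀ = a := fun a b => by simp [f, hne]
  have hf1 : ∀ a b, f a b i₁ = b := fun a b => by simp [f, hne.symm]
  have hf00 : f 0 0 = 0 := by simp [f]
  have hfadd : ∀ a b a' b', f a b + f a' b' = f (a + a') (b + b') := by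
    intro a b a' b'
    simp only [f, Pi.single_add]
    abel
  have hfneg : ∀ a b, -f a b = f (-a) (-b) := by
    intro a b
    simp only [f, Pi.single_neg]
    abel
  have hdot : ∀ a b, mdot μ (f a b) = μ i₀ * a + μ i₁ * b := by
    intro a b
    simp [mdot, f, Pi.single_apply, mul_add, Finset.sum_add_distrib]
  have hlex : ∀ a b : ℤ, 0 < a ∨ (a = 0 ∧ 0 < b) → ρ (ev (f a b)) v = 0 := by
    rintro a b (ha | ⟨rfl, hb⟩)
    · refine hhw _ ⟨i₀, fun j hj => absurd hj (by simp [i₀, Fin.lt_def]), ?_⟩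
      simpa [hf0] using ha
    · refine hhw _ ⟨i₁, fun j hj => ?_, ?_⟩
      · have : j ≠ i₁ := ne_of_lt hj
        simp [f, this]
      · simpa [hf1] using hb
  have hm : μ i₁ ≠ 0 := by
    have hf : f 0 1 ≠ 0 := fun h => by
      have := hf1 0 1
      simp [h] at this
    simpa [hdot] using hμ _ hf
  have hB : ∀ α β : Zn n, B (ev α) (ev β) = mdot μ (β - α) • ev (α + β) +
      (if α = -β then ((mdot μ α) ^ 3 - mdot μ α) / 12 else 0) • cv := by
    intro α β
    rw [hBe]
    split_ifs <;> ext <;> simp [ev, cv]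
  have hcomm : ∀ α β : Zn n, ∀ w, ρ (ev α) (ρ (ev β) w) = ρ (ev β) (ρ (ev α) w) +
      mdot μ (β - α) • ρ (ev (α + β)) w +
      (if α = -β then ((mdot μ α) ^ 3 - mdot μ α) / 12 else 0) • ρ cv w := by
    intro α β w
    have h := hLie (ev α) (ev β) w
    rw [hB, map_add, map_smul, map_smul] at h
    simp only [LinearMap.add_apply, LinearMap.smul_apply] at h
    rw [add_assoc, h]
    abel
  have hsub : ∀ a b a' b', f a' b' - f a b = f (a' - a) (b' - b) := by
    intro a b a' b'
    rw [sub_eq_add_neg, hfneg, hfadd, ← sub_eq_add_neg, ← sub_eq_add_neg]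
  have key := not_finite_eigenspace_of_rank_two (μ i₀) (μ i₁) hm (fun a b => ρ (ev (f a b)))
    (ρ cv) ?_ ?_ ?_ hlc hv (by simpa [hf00] using hwt) hc
    (fun b => hlex 1 b (Or.inl one_pos)) (fun b hb => hlex 0 b (Or.inr ⟨rfl, hb⟩))
  · exact ⟨lam - μ i₀, hf00 ▸ key⟩
  · intro a b a' b' w hab
    have hnot : f a b ≠ -f a' b' := by
      rw [hfneg]
      intro h
      have e0 := congrFun h i₀
      have e1 := congrFun h i₁
      rw [hf0, hf0] at e0
      rw [hf1, hf1] at e1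
      exact hab (by omega)
    simp only [hcomm (f a b), if_neg hnot, zero_smul, add_zero, hfadd, hsub, hdot, Int.cast_sub]
  · intro a b w
    have heq : f a b = -f (-a) (-b) := by simp [hfneg]
    simp only [hcomm (f a b), if_pos heq, hfadd, hsub, hdot, add_neg_cancel]
    congr 3
    push_cast
    ring
  · intro a b w
    have h := hLie cv (ev (f a b)) w
    rw [hcB, map_zero, LinearMap.zero_apply] at h
    exact (sub_eq_zero.mp h.symm)
end
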